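/- arXiv:1205.2379 — 5 statements merged into one kernel-verified Lean document; each statement's English description precedes it below -/
import Mathlib

section
/- Let D ⊆ ℝ^m be an open connected set and let L be a uniformly elliptic second-order operator on D with continuous, locally bounded coefficients. If u : D → ℝ is a C² function satisfying Lu = 0 on D and u attains its supremum (or its infimum) over D at some point of D, then u is constant. -/
/-- First partial derivative `∂u/∂xⱼ` of a scalar function on `ℝ^m`. -/
noncomputable def pd {m : ℕ} (u : (Fin m → ℝ) → ℝ) (j : Fin m) (x : Fin m → ℝ) : ℝ :=
  fderiv ℝ u x (Pi.single j 1)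

/-- Second partial derivative `∂²u/∂xᵢ∂xⱼ` of a scalar function on `ℝ^m`. -/
noncomputable def pd2 {m : ℕ} (u : (Fin m → ℝ) → ℝ) (i j : Fin m) (x : Fin m → ℝ) : ℝ :=
  fderiv ℝ (fun y => fderiv ℝ u y (Pi.single j 1)) x (Pi.single i 1)

/-- The second-order operator `L` with coefficients `a`, `b` applied to `u` at `x`:
`(Lu)(x) = ∑ᵢⱼ aⁱʲ(x) ∂²u/∂xᵢ∂xⱼ(x) + ∑ⱼ bʲ(x) ∂u/∂xⱼ(x)`. -/
noncomputable def Lop {m : ℕ} (a : (Fin m → ℝ) → Fin m → Fin m → ℝ)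
    (b : (Fin m → ℝ) → Fin m → ℝ) (u : (Fin m → ℝ) → ℝ) (x : Fin m → ℝ) : ℝ :=
  (∑ i, ∑ j, a x i j * pd2 u i j x) + ∑ j, b x j * pd u j x

/-- `a` is symmetric and uniformly elliptic on `D`. -/
def UniformlyElliptic {m : ℕ} (D : Set (Fin m → ℝ))
    (a : (Fin m → ℝ) → Fin m → Fin m → ℝ) : Prop :=
  (∀ x ∈ D, ∀ i j, a x i j = a x j i) ∧
  ∃ lam0 : ℝ, 0 < lam0 ∧
    ∀ x ∈ D, ∀ ξ : Fin m → ℝ, lam0 * ∑ i, (ξ i) ^ 2 ≤ ∑ i, ∑ j, a x i j * ξ i * ξ j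

/-- Squared Euclidean norm. -/
def sqN {m : ℕ} (x : Fin m → ℝ) : ℝ := ∑ i, (x i) ^ 2

lemma sqN_nonneg {m : ℕ} (x : Fin m → ℝ) : 0 ≤ sqN x :=
  Finset.sum_nonneg fun i _ => sq_nonneg _

lemma sqN_pos {m : ℕ} {x : Fin m → ℝ} (h : x ≠ 0) : 0 < sqN x := by
  obtain ⟨i, hi⟩ := Function.ne_iff.mp h
  have h1 : (x i) ^ 2 ≤ sqN x :=
    Finset.single_le_sum (f := fun i => (x i) ^ 2) (fun i _ => sq_nonneg _) (Finset.mem_univ i)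
  have h2 : 0 < (x i) ^ 2 := pow_pos_of_ne_zero_sq hi
  linarith
where
  pow_pos_of_ne_zero_sq {a : ℝ} (h : a ≠ 0) : 0 < a ^ 2 := by positivity

lemma sqN_continuous {m : ℕ} : Continuous (sqN : (Fin m → ℝ) → ℝ) := by
  unfold sqN; fun_prop

lemma sqN_parallelogram {m : ℕ} (x y : Fin m → ℝ) :
    sqN (x + y) = 2 * sqN x + 2 * sqN y - sqN (x - y) := by
  unfold sqN
  rw [Finset.mul_sum, Finset.mul_sum, ← Finset.sum_add_distrib, ← Finset.sum_sub_distrib]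
  exact Finset.sum_congr rfl fun i _ => by simp only [Pi.add_apply, Pi.sub_apply]; ring

lemma sqN_smul {m : ℕ} (c : ℝ) (x : Fin m → ℝ) : sqN (c • x) = c ^ 2 * sqN x := by
  unfold sqN
  rw [Finset.mul_sum]
  exact Finset.sum_congr rfl fun i _ => by simp only [Pi.smul_apply, smul_eq_mul]; ring

lemma sqN_sub_comm {m : ℕ} (x y : Fin m → ℝ) : sqN (x - y) = sqN (y - x) := by
  unfold sqN
  exact Finset.sum_congr rfl fun i _ => by simp only [Pi.sub_apply]; ring

/-- One-dimensional necessary conditions at a local maximum. -/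
lemma second_deriv_test {f f' : ℝ → ℝ} {c : ℝ}
    (h1 : ∀ᶠ t in nhds (0 : ℝ), HasDerivAt f (f' t) t) (h2 : HasDerivAt f' c 0)
    (hmax : IsLocalMax f 0) : f' 0 = 0 ∧ c ≤ 0 := by
  have h0 : f' 0 = 0 := hmax.hasDerivAt_eq_zero h1.self_of_nhds
  refine ⟨h0, ?_⟩
  by_contra hc
  push Not at hc
  have he : deriv f =ᶠ[nhds 0] f' := h1.mono fun t ht => ht.deriv
  have hdd : deriv (deriv f) 0 = c := by rw [he.deriv_eq]; exact h2.deriv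
  have hmin : IsLocalMin f 0 := by
    apply isLocalMin_of_deriv_deriv_pos
    · rw [hdd]; exact hc
    · rw [he.self_of_nhds]; exact h0
    · exact h1.self_of_nhds.continuousAt
  have hconst : f =ᶠ[nhds 0] fun _ => f 0 := by
    filter_upwards [hmax, hmin] with t ht1 ht2
    exact le_antisymm ht1 ht2
  have h3 : deriv f =ᶠ[nhds 0] fun _ => 0 := by
    have := hconst.deriv
    simpa using this
  have h4 : deriv (deriv f) 0 = 0 := by rw [h3.deriv_eq]; simp
  linarith

/-- Trace inequality. -/
lemma trace_nonpos {m : ℕ} (a Q : Fin m → Fin m → ℝ) (hs : ∀ i j, a i j = a j i)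
    (hp : ∀ ξ : Fin m → ℝ, 0 ≤ ∑ i, ∑ j, a i j * ξ i * ξ j)
    (hQ : ∀ ξ : Fin m → ℝ, ∑ i, ∑ j, Q i j * ξ i * ξ j ≤ 0) :
    ∑ i, ∑ j, a i j * Q i j ≤ 0 := by
  have hpsd : (Matrix.of a).PosSemidef := by
    refine Matrix.PosSemidef.of_dotProduct_mulVec_nonneg ?_ ?_
    · ext i j
      simp [Matrix.conjTranspose_apply, hs j i]
    · intro x
      refine le_of_le_of_eq (hp x) ?_
      simp only [dotProduct, Matrix.mulVec, Finset.mul_sum, Matrix.of_apply]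
      refine Finset.sum_congr rfl fun i _ => Finset.sum_congr rfl fun j _ => ?_
      simp only [Pi.star_apply, star_trivial]
      ring
  open scoped MatrixOrder in
  obtain ⟨B, hB⟩ := CStarAlgebra.nonneg_iff_eq_star_mul_self.mp hpsd.nonneg
  have hab : ∀ i j, a i j = ∑ k, B k i * B k j := by
    intro i j
    have := congrFun (congrFun hB i) j
    simpa [Matrix.mul_apply, Matrix.star_apply] using this
  have : ∑ i, ∑ j, a i j * Q i j = ∑ k, ∑ i, ∑ j, Q i j * B k i * B k j := by
    rw [Finset.sum_comm]
    simp_rw [hab, Finset.sum_mul]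
    rw [Finset.sum_comm]
    rw [Finset.sum_comm_cycle]
    exact Finset.sum_congr rfl fun i _ => Finset.sum_congr rfl fun j _ =>
      Finset.sum_congr rfl fun j _ => by ring
  rw [this]
  exact Finset.sum_nonpos fun k _ => hQ _

/-- The barrier function along a line. -/
lemma barrier_line {m : ℕ} (d ξ : Fin m → ℝ) (α : ℝ) :
    (∀ t : ℝ, HasDerivAt (fun t => Real.exp (-α * sqN (d + t • ξ)))
      (Real.exp (-α * sqN (d + t • ξ)) * (-α * (2 * ∑ i, (d i + t * ξ i) * ξ i))) t) ∧
    HasDerivAt (fun t : ℝ =>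
      Real.exp (-α * sqN (d + t • ξ)) * (-α * (2 * ∑ i, (d i + t * ξ i) * ξ i)))
      (Real.exp (-α * sqN d) * (4 * α ^ 2 * (∑ i, d i * ξ i) ^ 2 - 2 * α * sqN ξ)) 0 := by
  have h1 : ∀ t : ℝ, HasDerivAt (fun t => Real.exp (-α * sqN (d + t • ξ)))
      (Real.exp (-α * sqN (d + t • ξ)) * (-α * (2 * ∑ i, (d i + t * ξ i) * ξ i))) t := by
    intro t
    have : HasDerivAt (fun t : ℝ => sqN (d + t • ξ)) (2 * ∑ i, (d i + t * ξ i) * ξ i) t := by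
      unfold sqN
      rw [Finset.mul_sum]
      refine HasDerivAt.fun_sum fun i _ => ?_
      have h := ((((hasDerivAt_id t).mul_const (ξ i)).const_add (d i)).pow 2)
      exact h.congr_deriv (by simp; ring)
    exact (this.const_mul (-α)).exp
  refine ⟨h1, ?_⟩
  have h2 : HasDerivAt (fun t : ℝ => -α * (2 * ∑ i, (d i + t * ξ i) * ξ i))
      (-α * (2 * sqN ξ)) 0 := by
    refine HasDerivAt.const_mul _ (HasDerivAt.const_mul _ ?_)
    unfold sqN
    refine HasDerivAt.fun_sum fun i _ => ?_
    have h := (((hasDerivAt_id (0:ℝ)).mul_const (ξ i)).const_add (d i)).mul_const (ξ i)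
    exact h.congr_deriv (by simp; ring)
  exact ((h1 0).mul h2).congr_deriv (by simp; ring)

/-- A `C²` function along a line. -/
lemma u_line {m : ℕ} {D : Set (Fin m → ℝ)} (hDo : IsOpen D) {u : (Fin m → ℝ) → ℝ}
    (hu : ContDiffOn ℝ 2 u D) {p : Fin m → ℝ} (hp : p ∈ D) (ξ : Fin m → ℝ) :
    (∀ᶠ t in nhds (0 : ℝ), HasDerivAt (fun t : ℝ => u (p + t • ξ))
      (∑ j, ξ j * pd u j (p + t • ξ)) t) ∧
    HasDerivAt (fun t : ℝ => ∑ j, ξ j * pd u j (p + t • ξ))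
      (∑ i, ∑ j, pd2 u i j p * ξ i * ξ j) 0 := by
  have hsum : ξ = ∑ j, ξ j • (Pi.single j (1:ℝ) : Fin m → ℝ) := by
    conv_lhs => rw [pi_eq_sum_univ' ξ]
  have hlin : ∀ A : (Fin m → ℝ) →L[ℝ] ℝ, A ξ = ∑ j, ξ j * A (Pi.single j 1) := by
    intro A
    conv_lhs => rw [hsum]
    simp [map_sum]
  have hline : ∀ t : ℝ, HasDerivAt (fun t : ℝ => p + t • ξ) ξ t := by
    intro t
    simpa using ((hasDerivAt_id t).smul_const ξ).const_add p
  have hcont : Continuous (fun t : ℝ => p + t • ξ) := by fun_prop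
  constructor
  · have hev : ∀ᶠ t in nhds (0 : ℝ), p + t • ξ ∈ D :=
      hcont.continuousAt.eventually_mem (by simpa using hDo.mem_nhds hp)
    filter_upwards [hev] with t ht
    have hd : HasFDerivAt u (fderiv ℝ u (p + t • ξ)) (p + t • ξ) :=
      ((hu.contDiffAt (hDo.mem_nhds ht)).differentiableAt (by norm_num)).hasFDerivAt
    have := hd.comp_hasDerivAt t (hline t)
    rw [hlin] at this
    exact this
  · have hd2 : ∀ j, DifferentiableAt ℝ (pd u j) p := by
      intro j
      have h1 : ContDiffAt ℝ 1 (fderiv ℝ u) p :=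
        (hu.contDiffAt (hDo.mem_nhds hp)).fderiv_right (by norm_num)
      have h2 : DifferentiableAt ℝ (fderiv ℝ u) p := h1.differentiableAt (by norm_num)
      unfold pd
      exact h2.clm_apply (differentiableAt_const _)
    rw [Finset.sum_comm]
    refine HasDerivAt.fun_sum fun j _ => ?_
    have hd : HasFDerivAt (pd u j) (fderiv ℝ (pd u j) p) (p + (0:ℝ) • ξ) := by
      simpa using (hd2 j).hasFDerivAt
    have := (hd.comp_hasDerivAt 0 (hline 0)).const_mul (ξ j)
    rw [hlin, Finset.mul_sum] at this
    refine this.congr_deriv ?_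
    refine Finset.sum_congr rfl fun i _ => ?_
    unfold pd2 pd
    ring

/-- Core computation at an interior maximum of `u + ε exp(-α|x-c|²)`. -/
lemma core {m : ℕ} {D : Set (Fin m → ℝ)} (hDo : IsOpen D)
    {a : (Fin m → ℝ) → Fin m → Fin m → ℝ} {b : (Fin m → ℝ) → Fin m → ℝ}
    {u : (Fin m → ℝ) → ℝ} (hu : ContDiffOn ℝ 2 u D) {p c : Fin m → ℝ} (hp : p ∈ D)
    (hs : ∀ i j, a p i j = a p j i) {lam : ℝ} (hlam : 0 < lam)
    (hell : ∀ ξ : Fin m → ℝ, lam * ∑ i, (ξ i) ^ 2 ≤ ∑ i, ∑ j, a p i j * ξ i * ξ j)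
    (hL : Lop a b u p = 0) {α ε : ℝ} (hα : 0 < α) (hε : 0 < ε)
    (hmax : IsLocalMax (fun x => u x + ε * Real.exp (-α * sqN (x - c))) p) :
    2 * α * lam * sqN (p - c) ≤ ∑ j, b p j * (p - c) j + ∑ i, a p i i := by
  set d := p - c with hd
  set e := Real.exp (-α * sqN d) with he
  have hepos : 0 < ε * e := mul_pos hε (Real.exp_pos _)
  have key : ∀ ξ : Fin m → ℝ,
      (∑ j, ξ j * pd u j p = ε * e * (2 * α * ∑ i, d i * ξ i)) ∧
      (∑ i, ∑ j, pd2 u i j p * ξ i * ξ j) +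
        ε * (e * (4 * α ^ 2 * (∑ i, d i * ξ i) ^ 2 - 2 * α * sqN ξ)) ≤ 0 := by
    intro ξ
    obtain ⟨hu1, hu2⟩ := u_line hDo hu hp ξ
    obtain ⟨hb1, hb2⟩ := barrier_line d ξ α
    have hcont : Continuous (fun t : ℝ => p + t • ξ) := by fun_prop
    have hm : IsLocalMax (fun t : ℝ => u (p + t • ξ) +
        ε * Real.exp (-α * sqN (d + t • ξ))) 0 := by
      have h0 : IsLocalMax (fun x => u x + ε * Real.exp (-α * sqN (x - c)))
          ((fun t : ℝ => p + t • ξ) 0) := by simpa using hmax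
      have := h0.comp_continuous (g := fun t : ℝ => p + t • ξ) hcont.continuousAt
      convert this using 2 with t
      simp only [Function.comp, hd]
      rw [add_sub_right_comm]
    have := second_deriv_test (hu1.mono fun t ht => ht.add ((hb1 t).const_mul ε))
      (hu2.add (hb2.const_mul ε)) hm
    refine ⟨?_, this.2⟩
    have h1 := this.1
    simp only [Pi.add_apply, zero_smul, add_zero, zero_mul] at h1
    rw [← he] at h1
    linarith
  have hg : ∀ j, pd u j p = ε * e * (2 * α * d j) := by
    intro j
    have := (key (Pi.single j 1)).1
    simpa [Pi.single_apply] using this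
  have htr := trace_nonpos (a p)
    (fun i j => pd2 u i j p + ε * e * (4 * α ^ 2 * (d i * d j) - if i = j then 2 * α else 0)) hs
    (fun ξ => le_trans (mul_nonneg hlam.le (sqN_nonneg ξ)) (hell ξ)) (by
      intro ξ
      refine le_of_eq_of_le ?_ (key ξ).2
      have e1 : (∑ i, d i * ξ i) ^ 2 = ∑ i, ∑ j, d i * ξ i * (d j * ξ j) := by
        rw [sq, Finset.sum_mul_sum]
      have e2 : 2 * α * sqN ξ = ∑ i, ∑ j, (if i = j then 2 * α else 0) * ξ i * ξ j := by
        unfold sqN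
        rw [Finset.mul_sum]
        refine Finset.sum_congr rfl fun i _ => ?_
        simp [ite_mul]; ring
      rw [e1, e2]
      simp only [Finset.mul_sum, ← Finset.sum_sub_distrib, ← Finset.sum_add_distrib]
      refine Finset.sum_congr rfl fun i _ => Finset.sum_congr rfl fun j _ => ?_
      ring)
  have hexp : ∑ i, ∑ j, a p i j *
      (pd2 u i j p + ε * e * (4 * α ^ 2 * (d i * d j) - if i = j then 2 * α else 0)) =
      (∑ i, ∑ j, a p i j * pd2 u i j p) +
        ε * e * (4 * α ^ 2 * (∑ i, ∑ j, a p i j * d i * d j) - 2 * α * ∑ i, a p i i) := by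
    have e2 : 2 * α * ∑ i, a p i i = ∑ i, ∑ j, a p i j * (if i = j then 2 * α else 0) := by
      rw [Finset.mul_sum]
      refine Finset.sum_congr rfl fun i _ => ?_
      simp; ring
    rw [e2]
    simp only [Finset.mul_sum, ← Finset.sum_sub_distrib, ← Finset.sum_add_distrib]
    refine Finset.sum_congr rfl fun i _ => Finset.sum_congr rfl fun j _ => ?_
    ring
  rw [hexp] at htr
  unfold Lop at hL
  have hbg : ∑ j, b p j * pd u j p = ε * e * (2 * α * ∑ j, b p j * d j) := by
    simp only [Finset.mul_sum]
    exact Finset.sum_congr rfl fun j _ => by rw [hg]; ring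
  rw [hbg] at hL
  have h3 : (ε * e * (2 * α)) * (2 * α * (∑ i, ∑ j, a p i j * d i * d j) - ∑ i, a p i i
      - ∑ j, b p j * d j) ≤ 0 := by linarith
  have h4 : 2 * α * (∑ i, ∑ j, a p i j * d i * d j) - ∑ i, a p i i
      - ∑ j, b p j * d j ≤ 0 := by
    by_contra hc
    push Not at hc
    have := mul_pos (mul_pos hepos (by linarith : 0 < 2 * α)) hc
    linarith
  have h5 := mul_le_mul_of_nonneg_left (hell d) (by linarith : 0 ≤ 2 * α)
  unfold sqN
  linarith

/-- Touching-ball contradiction. -/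
lemma touching {m : ℕ} {D : Set (Fin m → ℝ)} (hDo : IsOpen D)
    {a : (Fin m → ℝ) → Fin m → Fin m → ℝ} {b : (Fin m → ℝ) → Fin m → ℝ}
    (hell : UniformlyElliptic D a)
    (haloc : ∀ x ∈ D, ∃ ε > (0 : ℝ), ∃ C : ℝ, ∀ y ∈ D, dist y x < ε →
      (∀ i j, |a y i j| ≤ C) ∧ (∀ j, |b y j| ≤ C))
    {u : (Fin m → ℝ) → ℝ} (hu : ContDiffOn ℝ 2 u D)
    (hLu : ∀ x ∈ D, Lop a b u x = 0) {z c : Fin m → ℝ} (hz : z ∈ D) (hzc : 0 < sqN (z - c))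
    (hle : ∀ x ∈ D, u x ≤ u z)
    (hlt : ∀ x ∈ D, sqN (x - c) ≤ sqN (z - c) → x ≠ z → u x < u z) : False := by
  obtain ⟨hs, lam, hlam, hell⟩ := hell
  obtain ⟨ε₀, hε₀, C, hC⟩ := haloc z hz
  have hN : Continuous fun x : Fin m → ℝ => sqN (x - c) :=
    sqN_continuous.comp (continuous_id.sub continuous_const)
  have hev : ∀ᶠ x in nhds z, x ∈ D ∧ dist x z < ε₀ ∧ sqN (z - c) / 2 < sqN (x - c) ∧
      ‖x - c‖ < ‖z - c‖ + 1 := by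
    refine Filter.Eventually.and (hDo.mem_nhds hz)
      (Filter.Eventually.and (Metric.ball_mem_nhds z hε₀) (Filter.Eventually.and ?_ ?_))
    · exact hN.continuousAt.eventually (lt_mem_nhds (by linarith))
    · have : Continuous fun x : Fin m → ℝ => ‖x - c‖ := by fun_prop
      exact this.continuousAt.eventually (gt_mem_nhds (by linarith))
  obtain ⟨ρ, hρ, hK⟩ := Metric.nhds_basis_closedBall.eventually_iff.mp hev
  set B := ‖z - c‖ + 1 with hB
  have hB0 : 0 ≤ B := by positivity
  set α := (m * |C| * (B + 1) + 1) / (lam * sqN (z - c)) with hα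
  have hαpos : 0 < α := by positivity
  have hαeq : α * lam * sqN (z - c) = m * |C| * (B + 1) + 1 := by
    rw [hα]; field_simp
  have hucont : ContinuousOn u (Metric.closedBall z ρ) :=
    hu.continuousOn.mono fun x hx => (hK hx).1
  have hδ : ∃ δ > 0, ∀ x ∈ Metric.sphere z ρ, sqN (x - c) ≤ sqN (z - c) → u x ≤ u z - δ := by
    have hS : IsCompact (Metric.sphere z ρ ∩ {x | sqN (x - c) ≤ sqN (z - c)}) :=
      (isCompact_sphere z ρ).inter_right (isClosed_le hN continuous_const)
    rcases (Metric.sphere z ρ ∩ {x | sqN (x - c) ≤ sqN (z - c)}).eq_empty_or_nonempty with h | h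
    · refine ⟨1, one_pos, fun x hx hx2 => ?_⟩
      have : x ∈ (∅ : Set (Fin m → ℝ)) := h ▸ ⟨hx, hx2⟩
      exact this.elim
    · obtain ⟨q, hq, hqm⟩ := hS.exists_isMaxOn h
        (hucont.mono fun x hx => Metric.sphere_subset_closedBall hx.1)
      refine ⟨u z - u q, ?_, fun x hx hx2 => ?_⟩
      · have := hlt q (hK (Metric.sphere_subset_closedBall hq.1)).1 hq.2
          (Metric.ne_of_mem_sphere hq.1 hρ.ne')
        linarith
      · have : u x ≤ u q := hqm ⟨hx, hx2⟩
        linarith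
  obtain ⟨δ, hδ, hδS⟩ := hδ
  obtain ⟨p, hpK, hpm⟩ := (isCompact_closedBall z ρ).exists_isMaxOn
    (f := fun x => u x + δ / 2 * Real.exp (-α * sqN (x - c)))
    ⟨z, Metric.mem_closedBall_self hρ.le⟩
    (hucont.add (Continuous.continuousOn (by fun_prop)))
  have hpz : u z + δ / 2 * Real.exp (-α * sqN (z - c)) ≤
      u p + δ / 2 * Real.exp (-α * sqN (p - c)) := hpm (Metric.mem_closedBall_self hρ.le)
  have hpball : p ∈ Metric.ball z ρ := by
    by_contra hnot
    have hsph : p ∈ Metric.sphere z ρ := by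
      simp only [Metric.mem_ball, Metric.mem_closedBall, Metric.mem_sphere, not_lt] at *
      exact le_antisymm hpK hnot
    rcases le_or_gt (sqN (p - c)) (sqN (z - c)) with h | h
    · have h1 := hδS p hsph h
      have h2 : Real.exp (-α * sqN (p - c)) ≤ 1 := by
        rw [Real.exp_le_one_iff]
        have := mul_nonneg hαpos.le (sqN_nonneg (p - c))
        linarith
      have h3 := Real.exp_pos (-α * sqN (z - c))
      nlinarith
    · have h1 := hle p (hK hpK).1
      have h2 : Real.exp (-α * sqN (p - c)) < Real.exp (-α * sqN (z - c)) := by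
        rw [Real.exp_lt_exp]
        nlinarith
      nlinarith
  have hlm : IsLocalMax (fun x => u x + δ / 2 * Real.exp (-α * sqN (x - c))) p :=
    hpm.isLocalMax (Filter.mem_of_superset (Metric.isOpen_ball.mem_nhds hpball)
      Metric.ball_subset_closedBall)
  obtain ⟨hpD, hpd, hpN, hpB⟩ := hK hpK
  have hcore := core hDo hu hpD (hs p hpD) hlam (hell p hpD) (hLu p hpD) hαpos
    (by linarith : 0 < δ / 2) hlm
  obtain ⟨hCa, hCb⟩ := hC p hpD hpd
  have h1 : ∑ i, a p i i ≤ m * |C| := by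
    have := Finset.sum_le_card_nsmul Finset.univ (fun i => a p i i) |C|
      (fun i _ => (le_abs_self _).trans ((hCa i i).trans (le_abs_self C)))
    simpa using this
  have h2 : ∑ j, b p j * (p - c) j ≤ m * (|C| * B) := by
    have := Finset.sum_le_card_nsmul Finset.univ (fun j => b p j * (p - c) j) (|C| * B)
      (fun j _ => by
        refine (le_abs_self _).trans ?_
        rw [abs_mul]
        exact mul_le_mul ((hCb j).trans (le_abs_self C))
          ((norm_le_pi_norm (p - c) j).trans hpB.le) (abs_nonneg _) (abs_nonneg _))
    simpa using this
  have h3 : α * lam * sqN (z - c) ≤ 2 * α * lam * sqN (p - c) := by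
    have := mul_le_mul_of_nonneg_left hpN.le (mul_pos hαpos hlam).le
    linarith
  nlinarith

lemma max_case {m : ℕ} {D : Set (Fin m → ℝ)} (hDo : IsOpen D) (hDc : IsConnected D)
    {a : (Fin m → ℝ) → Fin m → Fin m → ℝ} {b : (Fin m → ℝ) → Fin m → ℝ}
    (hell : UniformlyElliptic D a)
    (haloc : ∀ x ∈ D, ∃ ε > (0 : ℝ), ∃ C : ℝ, ∀ y ∈ D, dist y x < ε →
      (∀ i j, |a y i j| ≤ C) ∧ (∀ j, |b y j| ≤ C))
    {u : (Fin m → ℝ) → ℝ} (hu : ContDiffOn ℝ 2 u D)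
    (hLu : ∀ x ∈ D, Lop a b u x = 0) {x₀ : Fin m → ℝ} (hx₀ : x₀ ∈ D)
    (hle : ∀ x ∈ D, u x ≤ u x₀) : ∀ x ∈ D, u x = u x₀ := by
  have hloc : ∀ x₁ ∈ D, u x₁ = u x₀ → ∀ᶠ y in nhds x₁, u y = u x₀ := by
    intro x₁ hx₁ hux₁
    obtain ⟨r, hr, hrD⟩ := Metric.isOpen_iff.mp hDo x₁ hx₁
    -- Euclidean balls sit inside sup-norm balls
    have hcoord : ∀ x : Fin m → ℝ, sqN (x - x₁) < r ^ 2 → dist x x₁ < r := by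
      intro x hx
      rw [dist_pi_lt_iff hr]
      intro i
      have h1 : ((x - x₁) i) ^ 2 ≤ sqN (x - x₁) :=
        Finset.single_le_sum (f := fun i => ((x - x₁) i) ^ 2)
          (fun i _ => sq_nonneg _) (Finset.mem_univ i)
      rw [Real.dist_eq]
      exact abs_lt_of_sq_lt_sq (lt_of_le_of_lt h1 hx) hr.le
    set s := r ^ 2 / 8 with hs
    have hspos : 0 < s := by positivity
    have hin : ∀ x : Fin m → ℝ, sqN (x - x₁) ≤ 4 * s → x ∈ D := fun x hx =>
      hrD (hcoord x (by rw [hs] at hx; nlinarith))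
    have hN : ∀ c : Fin m → ℝ, Continuous fun x : Fin m → ℝ => sqN (x - c) := fun c =>
      sqN_continuous.comp (continuous_id.sub continuous_const)
    have hcl : IsCompact {x : Fin m → ℝ | sqN (x - x₁) ≤ 4 * s} := by
      refine (isCompact_closedBall x₁ r).of_isClosed_subset
        (isClosed_le (hN x₁) continuous_const) fun x hx => ?_
      exact (hcoord x (by have hx' : sqN (x - x₁) ≤ 4 * s := hx; rw [hs] at hx'; nlinarith)).le
    have hEc : IsCompact ({x : Fin m → ℝ | sqN (x - x₁) ≤ 4 * s} ∩ u ⁻¹' {u x₀}) := by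
      refine hcl.of_isClosed_subset ?_ Set.inter_subset_left
      exact (hu.continuousOn.mono fun x hx => hin x hx).preimage_isClosed_of_isClosed
        hcl.isClosed isClosed_singleton
    have hself : sqN (x₁ - x₁) = 0 := by simp [sqN]
    have hnear : ∀ᶠ y in nhds x₁, sqN (y - x₁) < s :=
      (hN x₁).continuousAt.eventually (gt_mem_nhds (by simpa only [hself] using hspos))
    filter_upwards [hnear] with y hy
    by_contra hne
    obtain ⟨z, ⟨hz1, hz2⟩, hzm⟩ := hEc.exists_isMinOn (f := fun x => sqN (x - y))
      ⟨x₁, by simp only [Set.mem_ofPred_eq, hself]; positivity, hux₁⟩ (hN y).continuousOn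
    have hzu : u z = u x₀ := hz2
    have hzy : sqN (z - y) < s := by
      have : sqN (z - y) ≤ sqN (x₁ - y) :=
        hzm ⟨by simp only [Set.mem_ofPred_eq, hself]; positivity, hux₁⟩
      rw [sqN_sub_comm x₁ y] at this
      linarith
    have hball : ∀ x ∈ D, sqN (x - y) < sqN (z - y) → u x < u z := by
      intro x hx hxy
      rw [hzu]
      refine lt_of_le_of_ne (hle x hx) fun hxe => ?_
      have h1 : sqN (x - x₁) ≤ 4 * s := by
        have := sqN_parallelogram (x - y) (y - x₁)
        rw [sub_add_sub_cancel] at this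
        have h2 := sqN_nonneg (x - y - (y - x₁))
        linarith
      have : sqN (z - y) ≤ sqN (x - y) := hzm ⟨h1, hxe⟩
      linarith
    have hzney : z - y ≠ 0 := by
      intro h
      rw [sub_eq_zero] at h
      rw [h] at hzu
      exact hne hzu
    have hzc : z - (y + (1/2 : ℝ) • (z - y)) = (1/2 : ℝ) • (z - y) := by
      ext i; simp; ring
    refine touching hDo hell haloc hu hLu (z := z) (c := y + (1/2 : ℝ) • (z - y))
      (hin z hz1) ?_ ?_ ?_
    · rw [hzc, sqN_smul]
      have := sqN_pos hzney
      positivity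
    · intro x hx
      rw [hzu]; exact hle x hx
    · intro x hx hxc hxz
      refine hball x hx ?_
      rw [hzc] at hxc
      have := sqN_parallelogram (x - (y + (1/2 : ℝ) • (z - y))) ((1/2 : ℝ) • (z - y))
      have e1 : x - (y + (1/2 : ℝ) • (z - y)) + (1/2 : ℝ) • (z - y) = x - y := by
        abel
      have e2 : x - (y + (1/2 : ℝ) • (z - y)) - (1/2 : ℝ) • (z - y) = x - z := by
        ext i; simp; ring
      rw [e1, e2] at this
      have hp := sqN_pos (sub_ne_zero.mpr hxz)
      rw [sqN_smul] at hxc this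
      linarith
  have ho1 : IsOpen (D ∩ {x | u x = u x₀}) := by
    rw [isOpen_iff_mem_nhds]
    intro x hx
    exact Filter.inter_mem (hDo.mem_nhds hx.1) (hloc x hx.1 hx.2)
  have ho2 : IsOpen (D ∩ u ⁻¹' {u x₀}ᶜ) :=
    hu.continuousOn.isOpen_inter_preimage hDo isOpen_compl_singleton
  have hsub := hDc.isPreconnected.subset_left_of_subset_union ho1 ho2
    (Set.disjoint_left.mpr fun x h1 h2 => h2.2 h1.2)
    (fun x hx => by
      by_cases h : u x = u x₀
      · exact Or.inl ⟨hx, h⟩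
      · exact Or.inr ⟨hx, h⟩) ⟨x₀, hx₀, hx₀, rfl⟩
  exact fun x hx => (hsub hx).2

lemma Lop_neg {m : ℕ} (a : (Fin m → ℝ) → Fin m → Fin m → ℝ)
    (b : (Fin m → ℝ) → Fin m → ℝ) (u : (Fin m → ℝ) → ℝ) (x : Fin m → ℝ) :
    Lop a b (fun y => - u y) x = - Lop a b u x := by
  have h1 : ∀ j y, pd (fun y => - u y) j y = - pd u j y := by
    intro j y
    simp [pd, fderiv_fun_neg]
  have h2 : ∀ i j y, pd2 (fun y => - u y) i j y = - pd2 u i j y := by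
    intro i j y
    simp [pd2, fderiv_fun_neg]
  simp only [Lop, h1, h2, mul_neg, Finset.sum_neg_distrib]
  ring

/-- **Hopf's strong maximum principle.** If `u` is a `C²` solution of `Lu = 0` on an open
connected set `D ⊆ ℝ^m`, where `L` is uniformly elliptic with continuous, locally bounded
coefficients, and `u` attains its supremum or infimum over `D` at an interior point,
then `u` is constant on `D`. -/
theorem strong_elliptic_maximum_principle_scalar
    (m : ℕ) (D : Set (Fin m → ℝ)) (hDo : IsOpen D) (hDc : IsConnected D)
    (a : (Fin m → ℝ) → Fin m → Fin m → ℝ) (b : (Fin m → ℝ) → Fin m → ℝ)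
    (hell : UniformlyElliptic D a)
    (hacont : ∀ i j, ContinuousOn (fun x => a x i j) D)
    (hbcont : ∀ j, ContinuousOn (fun x => b x j) D)
    (haloc : ∀ x ∈ D, ∃ ε > (0 : ℝ), ∃ C : ℝ, ∀ y ∈ D, dist y x < ε →
      (∀ i j, |a y i j| ≤ C) ∧ (∀ j, |b y j| ≤ C))
    (u : (Fin m → ℝ) → ℝ) (hu : ContDiffOn ℝ 2 u D)
    (hLu : ∀ x ∈ D, Lop a b u x = 0)
    (hext : (∃ x₀ ∈ D, ∀ x ∈ D, u x ≤ u x₀) ∨ (∃ x₀ ∈ D, ∀ x ∈ D, u x₀ ≤ u x)) :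
    ∀ x ∈ D, ∀ y ∈ D, u x = u y := by
  rcases hext with ⟨x₀, hx₀, h⟩ | ⟨x₀, hx₀, h⟩
  · have := max_case hDo hDc hell haloc hu hLu hx₀ h
    intro x hx y hy
    rw [this x hx, this y hy]
  · have := max_case (u := fun y => - u y) hDo hDc hell haloc hu.neg
      (fun x hx => by rw [Lop_neg, hLu x hx, neg_zero]) hx₀ (fun x hx => neg_le_neg (h x hx))
    intro x hx y hy
    have h1 := this x hx
    have h2 := this y hy
    simp only [neg_inj] at h1 h2
    rw [h1, h2]
end

section
/- Let D ⊆ ℝ^m be an open connected set, K ⊆ ℝⁿ a closed convex set, L a uniformly elliptic second-order operator on D with continuous coefficients, and Ψ : D × ℝⁿ → ℝⁿ a continuous map that is locally Lipschitz continuous in its second variable. Suppose u : D → ℝⁿ is a C² map with u(D) ⊆ K satisfying (Lu)(x) + Ψ(x, u(x)) = 0 for all x ∈ D, and that for every (x, y) ∈ D × ∂K the vector Ψ(x, y) points into K at y. If there exists x₀ ∈ D with u(x₀) ∈ ∂K, then u(x) ∈ ∂K for every x ∈ D. -/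
/-- The vector `η` points into the closed convex set `K` at the boundary point `y`
(i.e. lies in the tangent cone of `K` at `y`): `⟨ξ, η⟩ ≥ 0` for every `ξ` such that
`⟨ξ, z − y⟩ ≥ 0` for all `z ∈ K`. -/
def PointsInto {n : ℕ} (K : Set (Fin n → ℝ)) (y η : Fin n → ℝ) : Prop :=
  ∀ ξ : Fin n → ℝ, (∀ z ∈ K, 0 ≤ ∑ i, ξ i * (z i - y i)) → 0 ≤ ∑ i, ξ i * η i

theorem we_pd2_eq {m : ℕ} {f : (Fin m → ℝ) → ℝ} {x : Fin m → ℝ} (hf : ContDiffAt ℝ 2 f x)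
    (i j : Fin m) : pd2 f i j x = fderiv ℝ (fderiv ℝ f) x (Pi.single i 1) (Pi.single j 1) := by
  have hd : DifferentiableAt ℝ (fderiv ℝ f) x :=
    (hf.fderiv_right (m := 1) (by norm_num)).differentiableAt (by norm_num)
  unfold pd2
  have := (hd.hasFDerivAt.clm_apply (hasFDerivAt_const (Pi.single j (1:ℝ)) x)).fderiv
  rw [this]; simp

theorem we_Lop_add {m : ℕ} (a : (Fin m → ℝ) → Fin m → Fin m → ℝ)
    (b : (Fin m → ℝ) → Fin m → ℝ) {f g : (Fin m → ℝ) → ℝ} {x : Fin m → ℝ}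
    (hf : ContDiffAt ℝ 2 f x) (hg : ContDiffAt ℝ 2 g x) :
    Lop a b (fun z => f z + g z) x = Lop a b f x + Lop a b g x := by
  have hev : fderiv ℝ (fun z => f z + g z) =ᶠ[nhds x] fun z => fderiv ℝ f z + fderiv ℝ g z := by
    filter_upwards [hf.eventually (by simp), hg.eventually (by simp)] with z h1 h2
    exact fderiv_fun_add (h1.differentiableAt (by norm_num)) (h2.differentiableAt (by norm_num))
  have hd : DifferentiableAt ℝ (fderiv ℝ f) x :=
    (hf.fderiv_right (m := 1) (by norm_num)).differentiableAt (by norm_num)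
  have hd' : DifferentiableAt ℝ (fderiv ℝ g) x :=
    (hg.fderiv_right (m := 1) (by norm_num)).differentiableAt (by norm_num)
  have h2 : ∀ i j, pd2 (fun z => f z + g z) i j x = pd2 f i j x + pd2 g i j x := by
    intro i j
    rw [we_pd2_eq hf, we_pd2_eq hg, we_pd2_eq (hf.add hg), hev.fderiv_eq, fderiv_fun_add hd hd']
    simp
  have h1 : ∀ j, pd (fun z => f z + g z) j x = pd f j x + pd g j x := by
    intro j
    unfold pd
    rw [hev.self_of_nhds]; simp
  unfold Lop
  simp only [h1, h2, mul_add, Finset.sum_add_distrib]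
  ring

theorem we_Lop_const_mul {m : ℕ} (a : (Fin m → ℝ) → Fin m → Fin m → ℝ)
    (b : (Fin m → ℝ) → Fin m → ℝ) {f : (Fin m → ℝ) → ℝ} {x : Fin m → ℝ}
    (hf : ContDiffAt ℝ 2 f x) (k : ℝ) :
    Lop a b (fun z => k * f z) x = k * Lop a b f x := by
  have hev : fderiv ℝ (fun z => k * f z) =ᶠ[nhds x] fun z => k • fderiv ℝ f z := by
    filter_upwards [hf.eventually (by simp)] with z h1
    exact fderiv_const_mul (h1.differentiableAt (by norm_num)) k
  have hd : DifferentiableAt ℝ (fderiv ℝ f) x :=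
    (hf.fderiv_right (m := 1) (by norm_num)).differentiableAt (by norm_num)
  have h2 : ∀ i j, pd2 (fun z => k * f z) i j x = k * pd2 f i j x := by
    intro i j
    rw [we_pd2_eq hf, we_pd2_eq (contDiffAt_const.mul hf), hev.fderiv_eq, fderiv_fun_const_smul hd]
    simp
  have h1 : ∀ j, pd (fun z => k * f z) j x = k * pd f j x := by
    intro j
    unfold pd
    rw [hev.self_of_nhds]; simp
  unfold Lop
  simp only [h1, h2, mul_add, Finset.mul_sum]
  congr 1
  · exact Finset.sum_congr rfl fun i _ => Finset.sum_congr rfl fun j _ => by ring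
  · exact Finset.sum_congr rfl fun i _ => by ring

theorem we_Lop_zero {m : ℕ} (a : (Fin m → ℝ) → Fin m → Fin m → ℝ)
    (b : (Fin m → ℝ) → Fin m → ℝ) (x : Fin m → ℝ) :
    Lop a b (fun _ => 0) x = 0 := by
  simp [Lop, pd, pd2]

theorem we_Lop_sum {m n : ℕ} (a : (Fin m → ℝ) → Fin m → Fin m → ℝ)
    (b : (Fin m → ℝ) → Fin m → ℝ) {u : (Fin m → ℝ) → Fin n → ℝ} {x : Fin m → ℝ}
    (hu : ∀ i, ContDiffAt ℝ 2 (fun z => u z i) x) (ξ : Fin n → ℝ) (s : Finset (Fin n)) :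
    Lop a b (fun z => ∑ i ∈ s, ξ i * u z i) x = ∑ i ∈ s, ξ i * Lop a b (fun z => u z i) x := by
  classical
  induction s using Finset.induction_on with
  | empty => simpa using we_Lop_zero a b x
  | insert i s hi ih =>
    simp only [Finset.sum_insert hi]
    rw [we_Lop_add a b (contDiffAt_const.mul (hu i))
      (ContDiffAt.sum fun i _ => contDiffAt_const.mul (hu i)), ih, we_Lop_const_mul a b (hu i)]

theorem we_deriv2_nonneg {φ : ℝ → ℝ} (hc : ContDiffAt ℝ 2 φ 0) (hmin : IsLocalMin φ 0) :
    0 ≤ deriv (deriv φ) 0 := by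
  by_contra! h
  have hmax := isLocalMax_of_deriv_deriv_neg h hmin.deriv_eq_zero hc.continuousAt
  have hconst : φ =ᶠ[nhds 0] fun _ => φ 0 := by
    filter_upwards [hmin, hmax] with t h1 h2 using le_antisymm h2 h1
  have := hconst.deriv.deriv_eq
  simp at this
  linarith

theorem we_hess_nonneg {m : ℕ} {g : (Fin m → ℝ) → ℝ} {x : Fin m → ℝ} (hg : ContDiffAt ℝ 2 g x)
    (hmin : IsLocalMin g x) (ξ : Fin m → ℝ) : 0 ≤ fderiv ℝ (fderiv ℝ g) x ξ ξ := by
  have hd : DifferentiableAt ℝ (fderiv ℝ g) x :=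
    (hg.fderiv_right (m := 1) (by norm_num)).differentiableAt (by norm_num)
  have hline : ∀ t : ℝ, HasDerivAt (fun t : ℝ => x + t • ξ) ξ t := by
    intro t
    simpa using ((hasDerivAt_id t).smul_const ξ).const_add x
  have hx0 : x + (0:ℝ) • ξ = x := by simp
  have hcont : ContinuousAt (fun t : ℝ => x + t • ξ) 0 := (hline 0).continuousAt
  have htend : Filter.Tendsto (fun t : ℝ => x + t • ξ) (nhds 0) (nhds x) := by
    have := hcont.tendsto
    rwa [hx0] at this
  have hev : deriv (fun t : ℝ => g (x + t • ξ)) =ᶠ[nhds 0] fun t => fderiv ℝ g (x + t • ξ) ξ := by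
    filter_upwards [htend.eventually (hg.eventually (by simp))] with t ht
    exact ((ht.differentiableAt (by norm_num)).hasFDerivAt.comp_hasDerivAt t (hline t)).deriv
  have h2 : deriv (deriv (fun t : ℝ => g (x + t • ξ))) 0 = fderiv ℝ (fderiv ℝ g) x ξ ξ := by
    rw [hev.deriv_eq]
    have hd0 : HasFDerivAt (fderiv ℝ g) (fderiv ℝ (fderiv ℝ g) x) (x + (0:ℝ) • ξ) := by
      rw [hx0]; exact hd.hasFDerivAt
    have h3 : HasDerivAt (fun t : ℝ => fderiv ℝ g (x + t • ξ)) (fderiv ℝ (fderiv ℝ g) x ξ) 0 :=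
      hd0.comp_hasDerivAt (0:ℝ) (hline 0)
    have h4 : HasDerivAt (fun t : ℝ => fderiv ℝ g (x + t • ξ) ξ) (fderiv ℝ (fderiv ℝ g) x ξ ξ) 0 :=
      (ContinuousLinearMap.apply ℝ ℝ ξ).hasFDerivAt.comp_hasDerivAt (0:ℝ) h3
    exact h4.deriv
  rw [← h2]
  refine we_deriv2_nonneg ?_ ?_
  · have hg' : ContDiffAt ℝ 2 g (x + (0:ℝ) • ξ) := by rwa [hx0]
    exact hg'.comp (0:ℝ) (by fun_prop)
  · have : ∀ᶠ t in nhds (0:ℝ), g x ≤ g (x + t • ξ) := htend.eventually hmin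
    simpa [IsLocalMin, IsMinFilter] using this

open scoped MatrixOrder Matrix.Norms.L2Operator in
theorem we_Lop_nonneg {m : ℕ} (a : (Fin m → ℝ) → Fin m → Fin m → ℝ)
    (b : (Fin m → ℝ) → Fin m → ℝ) {g : (Fin m → ℝ) → ℝ} {x : Fin m → ℝ}
    (hg : ContDiffAt ℝ 2 g x) (hmin : IsLocalMin g x)
    (hsym : ∀ i j, a x i j = a x j i)
    (hpos : ∀ ξ : Fin m → ℝ, 0 ≤ ∑ i, ∑ j, a x i j * ξ i * ξ j) :
    0 ≤ Lop a b g x := by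
  have h1 : ∀ j, pd g j x = 0 := fun j => by simp [pd, hmin.fderiv_eq_zero]
  unfold Lop
  simp only [h1, mul_zero, Finset.sum_const_zero, add_zero]
  have hP : (Matrix.of (a x)).PosSemidef := by
    refine Matrix.PosSemidef.of_dotProduct_mulVec_nonneg ?_ ?_
    · ext i j; simp [hsym i j]
    · intro ξ
      refine (hpos ξ).trans_eq ?_
      simp only [dotProduct, Matrix.mulVec, Finset.mul_sum]
      refine Finset.sum_congr rfl fun i _ => Finset.sum_congr rfl fun j _ => ?_
      simp; ring
  obtain ⟨B, hB⟩ := CStarAlgebra.nonneg_iff_eq_star_mul_self.mp hP.nonneg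
  have hab : ∀ i j, a x i j = ∑ k, B k i * B k j := by
    intro i j
    have := congrFun (congrFun hB i) j
    simpa [Matrix.mul_apply, Matrix.star_apply] using this
  have key : ∀ k, fderiv ℝ (fderiv ℝ g) x (fun i => B k i) (fun i => B k i)
      = ∑ i, ∑ j, B k i * B k j * pd2 g i j x := by
    intro k
    have e : (fun i => B k i) = ∑ i, B k i • (Pi.single i 1 : Fin m → ℝ) := by
      ext j; simp [Finset.sum_apply, Pi.single_apply]
    rw [e]
    simp only [map_sum, map_smul, _root_.sum_apply, _root_.smul_apply, we_pd2_eq hg, smul_eq_mul, Finset.mul_sum]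
    rw [Finset.sum_comm]
    refine Finset.sum_congr rfl fun i _ => Finset.sum_congr rfl fun j _ => ?_
    ring
  have : ∑ i, ∑ j, a x i j * pd2 g i j x = ∑ k, ∑ i, ∑ j, B k i * B k j * pd2 g i j x := by
    simp only [hab, Finset.sum_mul]
    rw [Finset.sum_comm]
    rw [Finset.sum_congr rfl fun j _ => Finset.sum_comm]
    rw [Finset.sum_comm]
    refine Finset.sum_congr rfl fun k _ => ?_
    rw [Finset.sum_comm]
  rw [this]
  exact Finset.sum_nonneg fun k _ => by rw [← key]; exact we_hess_nonneg hg hmin _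

theorem we_hasFDerivAt_s {m : ℕ} (c : Fin m → ℝ) (R : ℝ) (y : Fin m → ℝ) :
    HasFDerivAt (fun z : Fin m → ℝ => R - ∑ i, (z i - c i) ^ 2)
      (-∑ i, (2 * (y i - c i)) • ContinuousLinearMap.proj (R := ℝ) (φ := fun _ : Fin m => ℝ) i) y := by
  refine HasFDerivAt.const_sub (HasFDerivAt.fun_sum fun i _ => ?_) R
  have h : HasFDerivAt (fun z : Fin m → ℝ => z i - c i)
      (ContinuousLinearMap.proj (R := ℝ) (φ := fun _ : Fin m => ℝ) i) y :=
    (ContinuousLinearMap.proj (R := ℝ) (φ := fun _ : Fin m => ℝ) i).hasFDerivAt.sub_const _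
  simpa using h.pow 2

theorem we_pd_v {m : ℕ} (c : Fin m → ℝ) (R β : ℝ) (j : Fin m) (y : Fin m → ℝ) :
    fderiv ℝ (fun z : Fin m → ℝ => (R - ∑ i, (z i - c i) ^ 2) + β * (R - ∑ i, (z i - c i) ^ 2) ^ 2) y
      (Pi.single j 1) = -(2 * (y j - c j)) * (1 + 2 * β * (R - ∑ i, (y i - c i) ^ 2)) := by
  have h := we_hasFDerivAt_s c R y
  rw [(h.fun_add ((h.pow 2).const_mul β)).fderiv]
  simp [Pi.single_apply]
  ring

theorem we_pd2_v {m : ℕ} (c : Fin m → ℝ) (R β : ℝ) (i j : Fin m) (y : Fin m → ℝ) :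
    pd2 (fun z : Fin m → ℝ => (R - ∑ i, (z i - c i) ^ 2) + β * (R - ∑ i, (z i - c i) ^ 2) ^ 2) i j y
      = (if i = j then -(2 * (1 + 2 * β * (R - ∑ i, (y i - c i) ^ 2))) else 0)
        + 8 * β * (y i - c i) * (y j - c j) := by
  unfold pd2
  simp only [we_pd_v]
  have h := we_hasFDerivAt_s c R y
  have h1 : HasFDerivAt (fun z : Fin m → ℝ => -(2 * (z j - c j)))
      (-((2 : ℝ) • ContinuousLinearMap.proj (R := ℝ) (φ := fun _ : Fin m => ℝ) j)) y :=
    (((ContinuousLinearMap.proj (R := ℝ) (φ := fun _ : Fin m => ℝ) j).hasFDerivAt.sub_const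
      (c j)).const_mul 2).neg
  rw [(h1.fun_mul ((h.const_mul (2 * β)).const_add 1)).fderiv]
  by_cases hij : i = j
  · subst hij; simp [Pi.single_apply]; ring
  · simp [Pi.single_apply, hij, Ne.symm hij, eq_comm]; ring

theorem we_Lop_v {m : ℕ} (a : (Fin m → ℝ) → Fin m → Fin m → ℝ)
    (b : (Fin m → ℝ) → Fin m → ℝ) (c : Fin m → ℝ) (R β : ℝ) (x : Fin m → ℝ) :
    Lop a b (fun z : Fin m → ℝ => (R - ∑ i, (z i - c i) ^ 2) + β * (R - ∑ i, (z i - c i) ^ 2) ^ 2) x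
      = (∑ i, ∑ j, a x i j * ((if i = j then -(2 * (1 + 2 * β * (R - ∑ i, (x i - c i) ^ 2))) else 0)
        + 8 * β * (x i - c i) * (x j - c j)))
        + ∑ j, b x j * (-(2 * (x j - c j)) * (1 + 2 * β * (R - ∑ i, (x i - c i) ^ 2))) := by
  unfold Lop pd
  simp only [we_pd_v, we_pd2_v]

/-- Lower bound for functionals supporting `K` in terms of the distance to the complement. -/
theorem we_support_bound {n : ℕ} {K : Set (Fin n → ℝ)} (f : (Fin n → ℝ) →L[ℝ] ℝ) {p y : Fin n → ℝ}
    (hp : p ∈ K) (hf : ∀ z ∈ K, f y ≤ f z) :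
    ‖f‖ * Metric.infDist p Kᶜ ≤ f p - f y := by
  set w := Metric.infDist p Kᶜ with hw
  have hw0 : 0 ≤ w := Metric.infDist_nonneg
  have hfp := hf p hp
  rcases hw0.eq_or_lt with h0 | h0
  · rw [← h0]; simpa using hfp
  have hball : Metric.ball p w ⊆ K := Metric.ball_infDist_compl_subset
  have hb : ‖f‖ ≤ (f p - f y) / w := by
    refine ContinuousLinearMap.opNorm_le_bound _ (div_nonneg (by linarith) hw0) fun z => ?_
    -- scaling
    have key : ∀ z : Fin n → ℝ, - f z ≤ (f p - f y) / w * ‖z‖ := by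
      intro z
      rcases eq_or_ne z 0 with rfl | hz
      · simp
      have hz' : 0 < ‖z‖ := norm_pos_iff.2 hz
      have : ∀ t : ℝ, 0 < t → t < w → -(f z) * t ≤ (f p - f y) * ‖z‖ := by
        intro t ht htw
        have hmem : p + (t / ‖z‖) • z ∈ K := by
          apply hball
          rw [Metric.mem_ball, dist_eq_norm, add_sub_cancel_left, norm_smul, Real.norm_eq_abs,
            abs_of_pos (by positivity), div_mul_cancel₀ _ hz'.ne']
          exact htw
        have := hf _ hmem
        rw [map_add, map_smul, smul_eq_mul] at this
        have h2 : -(f z) * t = -(t / ‖z‖ * f z) * ‖z‖ := by field_simp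
        rw [h2]
        exact mul_le_mul_of_nonneg_right (by linarith) hz'.le
      have h3 : -(f z) * w ≤ (f p - f y) * ‖z‖ := by
        by_cases hs : - f z ≤ 0
        · exact (mul_nonpos_of_nonpos_of_nonneg hs hw0).trans (mul_nonneg (by linarith) hz'.le)
        push Not at hs
        by_contra! hcon
        have hq : (f p - f y) * ‖z‖ / (-f z) < w := by
          rw [div_lt_iff₀ hs]; linarith
        obtain ⟨t, ht1, ht2⟩ := exists_between hq
        have ht0 : 0 < t := lt_of_le_of_lt (div_nonneg (mul_nonneg (by linarith) hz'.le) hs.le) ht1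
        have := this t ht0 ht2
        rw [div_lt_iff₀ hs] at ht1
        linarith
      rw [div_mul_eq_mul_div, le_div_iff₀ h0]; exact h3
    rw [Real.norm_eq_abs]
    refine abs_le'.2 ⟨?_, key z⟩
    simpa using key (-z)
  rwa [le_div_iff₀ h0] at hb

/-- Nearest boundary point together with a normalised supporting functional. -/
theorem we_nearest {n : ℕ} {K : Set (Fin n → ℝ)} (hKc : IsClosed K) (hKconv : Convex ℝ K)
    (hint : (interior K).Nonempty) (hne : Kᶜ.Nonempty) {p : Fin n → ℝ} (hp : p ∈ K) :
    ∃ y ∈ frontier K, dist p y = Metric.infDist p Kᶜ ∧ ∃ f : (Fin n → ℝ) →L[ℝ] ℝ,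
      ‖f‖ = 1 ∧ (∀ z ∈ K, f y ≤ f z) ∧ f p - f y = Metric.infDist p Kᶜ := by
  obtain ⟨y, hy, hd⟩ := Metric.exists_mem_closure_infDist_eq_dist hne p
  have hyK : y ∈ K := by
    rcases (Metric.infDist_nonneg (x := p) (s := Kᶜ)).eq_or_lt with h0 | h0
    · rw [← h0] at hd
      rwa [← dist_eq_zero.1 hd.symm]
    · have h1 : closure (Metric.ball p (Metric.infDist p Kᶜ)) ⊆ K :=
        hKc.closure_subset_iff.2 Metric.ball_infDist_compl_subset
      rw [closure_ball _ h0.ne'] at h1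
      apply h1
      rw [Metric.mem_closedBall, dist_comm, hd]
  have hyi : y ∉ interior K := by
    rw [closure_compl] at hy; exact hy
  have hyf : y ∈ frontier K := ⟨subset_closure hyK, hyi⟩
  obtain ⟨g, hg⟩ := geometric_hahn_banach_open_point hKconv.interior isOpen_interior hyi
  have hg0 : g ≠ 0 := by
    rintro rfl
    obtain ⟨q, hq⟩ := hint
    simpa using hg q hq
  have hgK : ∀ z ∈ K, g z ≤ g y := by
    intro z hz
    have hz' : z ∈ closure (interior K) := by
      rw [hKconv.closure_interior_eq_closure_of_nonempty_interior hint]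
      exact subset_closure hz
    exact closure_minimal (t := {z | g z ≤ g y}) (fun q hq => (hg q hq).le)
      (isClosed_le g.continuous continuous_const) hz'
  have hgn : 0 < ‖g‖ := norm_pos_iff.2 hg0
  have hf1 : ‖(-(‖g‖⁻¹)) • g‖ = 1 := by
    rw [norm_smul, norm_neg, norm_inv, norm_norm, inv_mul_cancel₀ hgn.ne']
  have hfK : ∀ z ∈ K, ((-(‖g‖⁻¹)) • g) y ≤ ((-(‖g‖⁻¹)) • g) z := by
    intro z hz
    have := mul_le_mul_of_nonneg_left (hgK z hz) (inv_nonneg.2 hgn.le)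
    simp only [_root_.smul_apply, smul_eq_mul]
    linarith
  refine ⟨y, hyf, hd.symm, (-(‖g‖⁻¹)) • g, hf1, hfK, le_antisymm ?_ ?_⟩
  · have := ((-(‖g‖⁻¹)) • g).le_opNorm (p - y)
    rw [hf1, one_mul, ← dist_eq_norm, ← hd, map_sub] at this
    exact (le_abs_self _).trans this
  · have := we_support_bound ((-(‖g‖⁻¹)) • g) hp hfK
    rwa [hf1, one_mul] at this

/-- Interior touching ball. -/
theorem we_touch {m : ℕ} {D Z : Set (Fin m → ℝ)} (hDo : IsOpen D) (hDc : IsConnected D)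
    (hZD : Z ⊆ D) (hZc : ∃ F, IsClosed F ∧ Z = D ∩ F) {x₀ x₁ : Fin m → ℝ} (h₀ : x₀ ∈ Z)
    (h₁ : x₁ ∈ D) (h₁' : x₁ ∉ Z) :
    ∃ xs ∈ Z, ∃ c : Fin m → ℝ, c ≠ xs ∧ ∀ᶠ x in nhds xs, x ∈ Z →
      ∑ i, (x i - c i) ^ 2 ≤ ∑ i, (xs i - c i) ^ 2 → x = xs := by
  obtain ⟨F, hF, rfl⟩ := hZc
  -- a boundary point of Z in D
  obtain ⟨x₂, hx₂, hx₂'⟩ : ∃ x₂ ∈ D ∩ F, x₂ ∈ closure (D \ F) := by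
    by_contra! hcon
    have := hDc.isPreconnected (Fᶜ) ((closure (D \ F))ᶜ) hF.isOpen_compl isClosed_closure.isOpen_compl
      (by
        intro x hx
        by_cases hxF : x ∈ F
        · exact Or.inr (hcon x ⟨hx, hxF⟩)
        · exact Or.inl hxF)
      ⟨x₁, h₁, fun h => h₁' ⟨h₁, h⟩⟩ ⟨x₀, h₀.1, hcon x₀ h₀⟩
    obtain ⟨z, hzD, hzF, hz⟩ := this
    exact hz (subset_closure ⟨hzD, hzF⟩)
  obtain ⟨ρ, hρ, hball⟩ := Metric.isOpen_iff.1 hDo x₂ hx₂.1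
  -- choose c close to x₂ with sum of squares small
  have hcont : Continuous fun c : Fin m → ℝ => ∑ i, (x₂ i - c i) ^ 2 := by fun_prop
  have hev : ∀ᶠ c in nhds x₂, ∑ i, (x₂ i - c i) ^ 2 < (ρ / 3) ^ 2 ∧ dist c x₂ < ρ / 3 := by
    refine Filter.Eventually.and ?_ (Metric.ball_mem_nhds _ (by positivity))
    refine (hcont.tendsto x₂).eventually (gt_mem_nhds ?_)
    simpa using by positivity
  obtain ⟨c, ⟨hcD, hcF⟩, hc1, hc2⟩ := ((mem_closure_iff_frequently.1 hx₂').and_eventually hev).exists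
  have hcomp : IsCompact (F ∩ Metric.closedBall c (ρ / 3)) :=
    (isCompact_closedBall c _).inter_left hF
  have hq : Continuous fun x : Fin m → ℝ => ∑ i, (x i - c i) ^ 2 := by fun_prop
  obtain ⟨xs, ⟨hxsF, hxsB⟩, hmin⟩ := hcomp.exists_isMinOn
    ⟨x₂, hx₂.2, by rw [Metric.mem_closedBall, dist_comm]; exact hc2.le⟩ hq.continuousOn
  have hmin' : ∀ x ∈ F, x ∈ Metric.closedBall c (ρ / 3) →
      ∑ i, (xs i - c i) ^ 2 ≤ ∑ i, (x i - c i) ^ 2 := fun x h1 h2 => hmin ⟨h1, h2⟩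
  have hR : ∑ i, (xs i - c i) ^ 2 < (ρ / 3) ^ 2 :=
    (hmin' x₂ hx₂.2 (by rw [Metric.mem_closedBall, dist_comm]; exact hc2.le)).trans_lt hc1
  have hxsc : c ≠ xs := fun h => hcF (h ▸ hxsF)
  have hxsD : xs ∈ D := by
    apply hball
    rw [Metric.mem_ball]
    rw [Metric.mem_closedBall] at hxsB
    have := dist_triangle xs c x₂
    linarith
  refine ⟨xs, ⟨hxsD, hxsF⟩, fun i => (c i + xs i) / 2, ?_, ?_⟩
  · intro h
    apply hxsc
    ext i
    have := congrFun h i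
    linarith
  refine Filter.Eventually.of_forall fun x hx hle => ?_
  by_contra hne
  have hpos : 0 < ∑ i, (x i - xs i) ^ 2 := by
    obtain ⟨i, hi⟩ := Function.ne_iff.1 hne
    exact Finset.sum_pos' (fun i _ => sq_nonneg _) ⟨i, Finset.mem_univ _, by
      have := sub_ne_zero.2 hi; positivity⟩
  have hid : ∑ i, (x i - c i) ^ 2 + ∑ i, (x i - xs i) ^ 2
      + 2 * ∑ i, (xs i - (c i + xs i) / 2) ^ 2
      = 2 * ∑ i, (x i - (c i + xs i) / 2) ^ 2 + ∑ i, (xs i - c i) ^ 2 := by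
    simp only [Finset.mul_sum, ← Finset.sum_add_distrib]
    exact Finset.sum_congr rfl fun i _ => by ring
  have hlt : ∑ i, (x i - c i) ^ 2 < ∑ i, (xs i - c i) ^ 2 := by
    linarith
  refine absurd (hmin' x hx.2 ?_) (not_le.2 hlt)
  rw [Metric.mem_closedBall, dist_pi_le_iff (by positivity)]
  intro i
  rw [Real.dist_eq]
  refine abs_le_of_sq_le_sq (le_trans ?_ (hlt.trans hR).le) (by positivity)
  exact Finset.single_le_sum (f := fun i => (x i - c i) ^ 2) (fun i _ => sq_nonneg _) (Finset.mem_univ i)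

/-- **Weinberger–Evans strong maximum principle for systems.**  If a `C²` map
`u : D → K ⊆ ℝⁿ` solves `Lu + Ψ(·, u) = 0` on the open connected set `D`, with `L`
uniformly elliptic with continuous coefficients, `K` closed and convex, `Ψ` continuous and
locally Lipschitz in the second variable and inward pointing on `∂K`, and `u(x₀) ∈ ∂K` for
some `x₀ ∈ D`, then `u(x) ∈ ∂K` for every `x ∈ D`. -/
theorem weinberger_evans_boundary
    (m n : ℕ) (D : Set (Fin m → ℝ)) (hDo : IsOpen D) (hDc : IsConnected D)
    (K : Set (Fin n → ℝ)) (hKc : IsClosed K) (hKconv : Convex ℝ K)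
    (a : (Fin m → ℝ) → Fin m → Fin m → ℝ) (b : (Fin m → ℝ) → Fin m → ℝ)
    (hell : UniformlyElliptic D a)
    (hacont : ∀ i j, ContinuousOn (fun x => a x i j) D)
    (hbcont : ∀ j, ContinuousOn (fun x => b x j) D)
    (Ψ : (Fin m → ℝ) → (Fin n → ℝ) → (Fin n → ℝ))
    (hΨcont : ContinuousOn (fun p : (Fin m → ℝ) × (Fin n → ℝ) => Ψ p.1 p.2)
      (D ×ˢ (Set.univ : Set (Fin n → ℝ))))
    (hΨlip : ∀ x₀ ∈ D, ∀ y₀ : Fin n → ℝ, ∃ ε > (0 : ℝ), ∃ C : ℝ,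
      ∀ x ∈ D, dist x x₀ < ε → ∀ y₁ y₂ : Fin n → ℝ, dist y₁ y₀ < ε → dist y₂ y₀ < ε →
        dist (Ψ x y₁) (Ψ x y₂) ≤ C * dist y₁ y₂)
    (hΨin : ∀ x ∈ D, ∀ y ∈ frontier K, PointsInto K y (Ψ x y))
    (u : (Fin m → ℝ) → (Fin n → ℝ))
    (hu : ∀ i, ContDiffOn ℝ 2 (fun x => u x i) D)
    (huK : ∀ x ∈ D, u x ∈ K)
    (heq : ∀ x ∈ D, ∀ i, Lop a b (fun y => u y i) x + Ψ x (u x) i = 0)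
    (x₀ : Fin m → ℝ) (hx₀ : x₀ ∈ D) (hbd : u x₀ ∈ frontier K) :
    ∀ x ∈ D, u x ∈ frontier K := by
  intro x₁ hx₁
  by_contra hxf
  have hint : (interior K).Nonempty := by
    by_contra h
    exact hxf ⟨subset_closure (huK x₁ hx₁), fun h' => h ⟨_, h'⟩⟩
  have hne : Kᶜ.Nonempty := by
    by_contra h
    rw [Set.not_nonempty_iff_eq_empty, Set.compl_empty_iff] at h
    rw [h, frontier_univ] at hbd
    exact hbd
  have hucont : ContinuousOn u D := continuousOn_pi.2 fun i => (hu i).continuousOn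
  have huat : ∀ x ∈ D, ∀ i, ContDiffAt ℝ 2 (fun z => u z i) x := fun x hx i =>
    (hu i).contDiffAt (hDo.mem_nhds hx)
  have hwcont : ContinuousOn (fun x => Metric.infDist (u x) Kᶜ) D :=
    (Metric.continuous_infDist_pt _).comp_continuousOn hucont
  have hw0 : ∀ x ∈ D, Metric.infDist (u x) Kᶜ = 0 → u x ∈ frontier K := by
    intro x hx h
    refine ⟨subset_closure (huK x hx), ?_⟩
    have := (Metric.mem_closure_iff_infDist_zero hne).2 h
    rwa [closure_compl] at this
  have hw0' : ∀ x, u x ∈ frontier K → u x ∈ closure Kᶜ := by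
    intro x h
    rw [closure_compl]
    exact h.2
  obtain ⟨hsym, lam0, hlam, hellip⟩ := hell
  obtain ⟨F, hF, hFeq⟩ := continuousOn_iff_isClosed.1 hucont (frontier K) isClosed_frontier
  have hZ : {x | x ∈ D ∧ u x ∈ frontier K} = D ∩ F := by
    rw [Set.inter_comm D F, ← hFeq]
    ext x
    exact and_comm
  obtain ⟨xs, ⟨hxsD, hxsf⟩, c, hc, hev⟩ := we_touch (Z := {x | x ∈ D ∧ u x ∈ frontier K}) hDo hDc
    (fun x hx => hx.1) ⟨F, hF, hZ⟩ (x₀ := x₀) ⟨hx₀, hbd⟩ hx₁ (fun h => hxf h.2)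
  have hDn : D ∈ nhds xs := hDo.mem_nhds hxsD
  obtain ⟨δ, hδ, C₀, hlip⟩ := hΨlip xs hxsD (u xs)
  set C := max C₀ 0 with hCdef
  have hC0 : 0 ≤ C := le_max_right _ _
  set R := ∑ i, (xs i - c i) ^ 2 with hRdef
  have hR : 0 < R := by
    obtain ⟨i, hi⟩ := Function.ne_iff.1 hc
    exact Finset.sum_pos' (fun i _ => sq_nonneg _) ⟨i, Finset.mem_univ _, by
      have := sub_ne_zero.2 (Ne.symm hi); positivity⟩
  set A := ∑ i, ∑ j, a xs i j * (xs i - c i) * (xs j - c j) with hA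
  have hApos : 0 < A := lt_of_lt_of_le (mul_pos hlam hR) (hellip xs hxsD fun i => xs i - c i)
  set P := (∑ i, ∑ j, a xs i j * (if i = j then -2 else 0)) + ∑ j, b xs j * (-(2 * (xs j - c j)))
    with hP
  set β := (|P| + 1) / (8 * A) with hβ
  have hβpos : 0 < β := by positivity
  set v : (Fin m → ℝ) → ℝ := fun z =>
    (R - ∑ i, (z i - c i) ^ 2) + β * (R - ∑ i, (z i - c i) ^ 2) ^ 2 with hv
  have hvsmooth : ContDiff ℝ 2 v := by
    rw [hv]; fun_prop
  have hvcont : Continuous v := hvsmooth.continuous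
  have hvxs : v xs = 0 := by simp [hv, ← hRdef]
  have hLv : 0 < Lop a b v xs := by
    rw [hv, we_Lop_v]
    simp only [← hRdef, sub_self, mul_zero, add_zero, mul_one]
    have : (∑ i, ∑ j, a xs i j * ((if i = j then -2 else 0) + 8 * β * (xs i - c i) * (xs j - c j)))
        + ∑ j, b xs j * (-(2 * (xs j - c j))) = P + 8 * β * A := by
      rw [hP, hA]
      simp only [mul_add, Finset.sum_add_distrib, Finset.mul_sum]
      have e : ∀ i j, a xs i j * (8 * β * (xs i - c i) * (xs j - c j))
        = 8 * β * (a xs i j * (xs i - c i) * (xs j - c j)) := fun i j => by ring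
      simp only [e]
      ring
    rw [this]
    have e2 : 8 * β * A = |P| + 1 := by rw [hβ]; field_simp
    rw [e2]
    linarith [neg_abs_le P]
  have hLcont : ContinuousAt (fun x => Lop a b v x - C * v x) xs := by
    refine ContinuousAt.sub ?_ (continuous_const.mul hvcont).continuousAt
    have haat : ∀ i j, ContinuousAt (fun x => a x i j) xs := fun i j =>
      (hacont i j).continuousAt hDn
    have hbat : ∀ j, ContinuousAt (fun x => b x j) xs := fun j => (hbcont j).continuousAt hDn
    have hfun : Lop a b v = _ := funext fun x => we_Lop_v a b c R β x
    rw [hfun]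
    refine ContinuousAt.add ?_ ?_
    · refine tendsto_finsetSum _ fun i _ => tendsto_finsetSum _ fun j _ => ?_
      refine (haat i j).mul (Continuous.continuousAt ?_)
      split_ifs <;> fun_prop
    · refine tendsto_finsetSum _ fun j _ => ?_
      exact (hbat j).mul (Continuous.continuousAt (by fun_prop))
  have hev1 : ∀ᶠ x in nhds xs, 0 < Lop a b v x - C * v x :=
    hLcont.tendsto.eventually (lt_mem_nhds (by rw [hvxs]; simpa using hLv))
  have hev2 : ∀ᶠ x in nhds xs, 0 < 1 + β * (R - ∑ i, (x i - c i) ^ 2) := by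
    have hcc : Continuous fun x : Fin m → ℝ => 1 + β * (R - ∑ i, (x i - c i) ^ 2) := by fun_prop
    exact (hcc.tendsto xs).eventually (lt_mem_nhds (by simp [← hRdef]))
  have hev3 : ∀ᶠ x in nhds xs, dist (u x) (u xs) < δ / 2 :=
    (hucont.continuousAt hDn).tendsto.eventually (Metric.ball_mem_nhds _ (by positivity))
  have hev4 : ∀ᶠ x in nhds xs, dist x xs < δ := Metric.ball_mem_nhds _ hδ
  obtain ⟨r, hr, hball⟩ := Metric.nhds_basis_closedBall.eventually_iff.1
    (hev.and (hev1.and (hev2.and (hev3.and (hev4.and hDn)))))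
  -- positivity of the difference on the sphere
  have hsph : ∀ x ∈ Metric.sphere xs r, v x < 0 ∨ 0 < Metric.infDist (u x) Kᶜ := by
    intro x hx
    obtain ⟨k0, k1, k2, k3, k4, k5⟩ := hball (Metric.sphere_subset_closedBall hx)
    rcases (Metric.infDist_nonneg (x := u x) (s := Kᶜ)).eq_or_lt with h | h
    · left
      have hxne : x ≠ xs := by
        rintro rfl
        rw [Metric.mem_sphere, dist_self] at hx
        exact hr.ne hx
      have h1 : R < ∑ i, (x i - c i) ^ 2 := by
        by_contra! hcon
        exact hxne (k0 ⟨k5, hw0 x k5 h.symm⟩ hcon)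
      have : v x = (R - ∑ i, (x i - c i) ^ 2) * (1 + β * (R - ∑ i, (x i - c i) ^ 2)) := by
        simp only [hv]; ring
      rw [this]
      exact mul_neg_of_neg_of_pos (by linarith) k2
    · exact Or.inr h
  have hBD : Metric.closedBall xs r ⊆ D := fun x hx => (hball hx).2.2.2.2.2
  obtain ⟨ε, hε, hεS⟩ : ∃ ε > (0:ℝ), ∀ x ∈ Metric.sphere xs r,
      0 < Metric.infDist (u x) Kᶜ - ε * v x := by
    have hcomp : IsCompact (Metric.sphere xs r ∩ {x | 0 ≤ v x}) :=
      (isCompact_sphere xs r).inter_right (isClosed_le continuous_const hvcont)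
    rcases (Metric.sphere xs r ∩ {x | 0 ≤ v x}).eq_empty_or_nonempty with he | hnon
    · refine ⟨1, one_pos, fun x hx => ?_⟩
      have : v x < 0 := by
        by_contra! h
        have : x ∈ Metric.sphere xs r ∩ {x | 0 ≤ v x} := ⟨hx, h⟩
        rw [he] at this
        exact this
      have := Metric.infDist_nonneg (x := u x) (s := Kᶜ)
      linarith
    · obtain ⟨p, hp, hpmin⟩ := hcomp.exists_isMinOn hnon
        (hwcont.mono fun x hx => hBD (Metric.sphere_subset_closedBall hx.1))
      obtain ⟨q, hq, hqmax⟩ := hcomp.exists_isMaxOn hnon hvcont.continuousOn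
      have hpp : 0 < Metric.infDist (u p) Kᶜ := (hsph p hp.1).resolve_left (not_lt.2 hp.2)
      have hq0 : 0 ≤ v q := hq.2
      refine ⟨Metric.infDist (u p) Kᶜ / (v q + 1), by positivity, fun x hx => ?_⟩
      by_cases hvx : 0 ≤ v x
      · have h1 : Metric.infDist (u p) Kᶜ ≤ Metric.infDist (u x) Kᶜ := hpmin ⟨hx, hvx⟩
        have h2 : v x ≤ v q := hqmax ⟨hx, hvx⟩
        have h3 : Metric.infDist (u p) Kᶜ / (v q + 1) * v x < Metric.infDist (u p) Kᶜ := by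
          rw [div_mul_eq_mul_div, div_lt_iff₀ (by linarith)]
          exact mul_lt_mul_of_pos_left (by linarith) hpp
        linarith
      · push Not at hvx
        have h1 := Metric.infDist_nonneg (x := u x) (s := Kᶜ)
        have h2 : 0 < Metric.infDist (u p) Kᶜ / (v q + 1) := by positivity
        have := mul_neg_of_pos_of_neg h2 hvx
        linarith
  obtain ⟨p, hpB, hpmin⟩ := (isCompact_closedBall xs r).exists_isMinOn
    ⟨xs, Metric.mem_closedBall_self hr.le⟩
    ((hwcont.mono hBD).sub ((continuous_const.mul hvcont).continuousOn (s := Metric.closedBall xs r)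
      : ContinuousOn (fun x => ε * v x) _))
  have hpmin' : ∀ x ∈ Metric.closedBall xs r,
      Metric.infDist (u p) Kᶜ - ε * v p ≤ Metric.infDist (u x) Kᶜ - ε * v x := fun x hx => hpmin hx
  have hp0 : Metric.infDist (u p) Kᶜ ≤ ε * v p := by
    have := hpmin' xs (Metric.mem_closedBall_self hr.le)
    rw [hvxs, (Metric.mem_closure_iff_infDist_zero hne).1 (hw0' xs hxsf)] at this
    linarith
  have hpint : p ∈ Metric.ball xs r := by
    rw [Metric.mem_ball]
    refine lt_of_le_of_ne hpB fun h => ?_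
    have := hεS p h
    linarith
  obtain ⟨-, k1, -, k3, k4, hpD⟩ := hball hpB
  obtain ⟨y, hyf, hyd, f, hf1, hfK, hfp⟩ := we_nearest hKc hKconv hint hne (huK p hpD)
  have hfsum : ∀ z : Fin n → ℝ, f z = ∑ i, f (Pi.single i 1) * z i := by
    intro z
    have e : z = ∑ i, z i • (Pi.single i 1 : Fin n → ℝ) := by
      ext j; simp [Finset.sum_apply, Pi.single_apply]
    conv_lhs => rw [e]
    simp [map_sum, mul_comm]
  set w := Metric.infDist (u p) Kᶜ with hw
  have hwle : w ≤ dist (u p) (u xs) := by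
    rw [hw, ← Metric.infDist_closure]
    exact Metric.infDist_le_dist_of_mem (hw0' xs hxsf)
  -- the right-hand side estimate
  have hΨ1 : 0 ≤ f (Ψ p y) := by
    rw [hfsum]
    refine hΨin p hpD y hyf _ fun z hz => ?_
    have h1 := hfK z hz
    have h2 : f (z - y) = ∑ i, f (Pi.single i 1) * (z i - y i) := hfsum (z - y)
    rw [← h2, map_sub]
    linarith
  have hΨ2 : dist (Ψ p (u p)) (Ψ p y) ≤ C * w := by
    have h1 : dist y (u xs) < δ := by
      have := dist_triangle y (u p) (u xs)
      rw [dist_comm y (u p), hyd] at this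
      linarith
    refine (hlip p hpD k4 (u p) y (by linarith) h1).trans ?_
    rw [hyd]
    exact mul_le_mul_of_nonneg_right (le_max_left _ _) Metric.infDist_nonneg
  have hΨ3 : -(C * w) ≤ f (Ψ p (u p)) := by
    have h1 := f.le_opNorm (Ψ p (u p) - Ψ p y)
    rw [hf1, one_mul, ← dist_eq_norm, map_sub, Real.norm_eq_abs] at h1
    have h2 := (abs_le.1 (h1.trans hΨ2)).1
    linarith
  -- the test function
  have hsumsm : ContDiffAt ℝ 2 (fun z => ∑ i, f (Pi.single i 1) * u z i) p :=
    ContDiffAt.sum fun i _ => contDiffAt_const.mul (huat p hpD i)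
  have hvsm : ContDiffAt ℝ 2 (fun z => (-ε) * v z) p := contDiffAt_const.mul hvsmooth.contDiffAt
  have hmin : IsLocalMin (fun z => (∑ i, f (Pi.single i 1) * u z i) + (-ε) * v z) p := by
    filter_upwards [Metric.isOpen_ball.mem_nhds hpint] with z hz
    have hzB := Metric.ball_subset_closedBall hz
    rw [← hfsum, ← hfsum]
    have h1 := we_support_bound f (huK z (hBD hzB)) hfK
    rw [hf1, one_mul] at h1
    have h2 := hpmin' z hzB
    linarith
  have hL := we_Lop_nonneg a b (hsumsm.add hvsm) hmin (hsym p hpD) fun ξ =>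
    le_trans (mul_nonneg hlam.le (Finset.sum_nonneg fun i _ => sq_nonneg _)) (hellip p hpD ξ)
  rw [we_Lop_add a b hsumsm hvsm, we_Lop_sum a b (huat p hpD),
    we_Lop_const_mul a b hvsmooth.contDiffAt] at hL
  have hLu : ∑ i, f (Pi.single i 1) * Lop a b (fun z => u z i) p = - f (Ψ p (u p)) := by
    rw [hfsum (Ψ p (u p)), ← Finset.sum_neg_distrib]
    refine Finset.sum_congr rfl fun i _ => ?_
    have := heq p hpD i
    rw [eq_neg_of_add_eq_zero_left this]
    ring
  rw [hLu] at hL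
  have h5 : C * w ≤ C * (ε * v p) := mul_le_mul_of_nonneg_left hp0 hC0
  have h6 : 0 < ε * (Lop a b v p - C * v p) := mul_pos hε k1
  nlinarith
end

section
/- Let D ⊆ ℝ^m be an open connected set, let K ⊆ ℝⁿ be a closed convex cone with vertex 0 that is strictly convex at 0, let L be a uniformly elliptic second-order operator on D with continuous coefficients, and let Ψ : D × ℝⁿ → ℝⁿ be a continuous map that is locally Lipschitz continuous in its second variable such that Ψ(x, y) points into K at y for every (x, y) ∈ D × ∂K. If u : D → ℝⁿ is a C² map with u(D) ⊆ K satisfying (Lu)(x) + Ψ(x, u(x)) = 0 for all x ∈ D, and u(x₀) = 0 for some x₀ ∈ D, then u vanishes identically on D. -/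
/-- `K` is strictly convex at `y` if `y` does not lie on any open segment joining two
distinct points of `K`. -/
def StrictlyConvexAt {n : ℕ} (K : Set (Fin n → ℝ)) (y : Fin n → ℝ) : Prop :=
  ∀ z ∈ K, ∀ w ∈ K, z ≠ w → ∀ t : ℝ, 0 < t → t < 1 → y ≠ t • z + (1 - t) • w


open Set Filter Topology

lemma clm_apply_eq_sum {m : ℕ} (l : (Fin m → ℝ) →L[ℝ] ℝ) (v : Fin m → ℝ) :
    l v = ∑ i, v i * l (Pi.single i 1) := by
  conv_lhs => rw [← Finset.univ_sum_single v]
  rw [map_sum]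
  refine Finset.sum_congr rfl fun i _ => ?_
  rw [← smul_eq_mul, ← map_smul, ← Pi.single_smul, smul_eq_mul, mul_one]

lemma diff_pd {m : ℕ} {w : (Fin m → ℝ) → ℝ} {x : Fin m → ℝ} (hw : ContDiffAt ℝ 2 w x)
    (j : Fin m) : DifferentiableAt ℝ (pd w j) x := by
  have h1 : ContDiffAt ℝ 1 (fderiv ℝ w) x := hw.fderiv_right (by norm_num)
  exact (h1.differentiableAt (by norm_num)).clm_apply (differentiableAt_const _)

lemma ev_diff {m : ℕ} {w : (Fin m → ℝ) → ℝ} {x : Fin m → ℝ} (hw : ContDiffAt ℝ 2 w x) :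
    ∀ᶠ y in 𝓝 x, DifferentiableAt ℝ w y := by
  filter_upwards [hw.eventually (by simp)] with y hy
  exact hy.differentiableAt (by norm_num)

lemma hess_nonneg {m : ℕ} {w : (Fin m → ℝ) → ℝ} {x : Fin m → ℝ} (hw : ContDiffAt ℝ 2 w x)
    (hmin : IsLocalMin w x) (v : Fin m → ℝ) :
    0 ≤ ∑ i, ∑ j, v i * v j * pd2 w i j x := by
  have hline : ∀ t : ℝ, HasDerivAt (fun t : ℝ => x + t • v) v t := by
    intro t
    simpa using ((hasDerivAt_id t).smul_const v).const_add x
  have hx0 : x + (0 : ℝ) • v = x := by simp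
  have htend : Tendsto (fun t : ℝ => x + t • v) (𝓝 0) (𝓝 x) := by
    have := (hline 0).continuousAt.tendsto
    rwa [hx0] at this
  set g : ℝ → ℝ := fun t => w (x + t • v) with hg
  have hgd : ∀ᶠ t in 𝓝 (0 : ℝ), deriv g t = ∑ j, v j * pd w j (x + t • v) := by
    filter_upwards [htend.eventually (ev_diff hw)] with t ht
    have := (ht.hasFDerivAt.comp_hasDerivAt t (hline t)).deriv
    rw [clm_apply_eq_sum] at this
    exact this
  have hdd : deriv (deriv g) 0 = ∑ i, ∑ j, v i * v j * pd2 w i j x := by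
    rw [Filter.EventuallyEq.deriv_eq hgd]
    have : HasDerivAt (fun t : ℝ => ∑ j, v j * pd w j (x + t • v))
        (∑ j, v j * (fderiv ℝ (pd w j) x v)) 0 := by
      refine HasDerivAt.fun_sum fun j _ => ?_
      refine HasDerivAt.const_mul _ ?_
      have h := (diff_pd hw j).hasFDerivAt
      rw [← hx0] at h
      have := h.comp_hasDerivAt (0 : ℝ) (hline 0)
      rw [hx0] at this
      exact this
    rw [this.deriv, Finset.sum_comm]
    refine Finset.sum_congr rfl fun j _ => ?_
    rw [clm_apply_eq_sum, Finset.mul_sum]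
    refine Finset.sum_congr rfl fun i _ => ?_
    change v j * (v i * pd2 w i j x) = _
    ring
  rw [← hdd]
  by_contra hneg
  push Not at hneg
  have hgmin : IsLocalMin g 0 := by
    have : ∀ᶠ y in 𝓝 x, w x ≤ w y := hmin
    filter_upwards [htend.eventually this] with t ht
    simpa [hg] using ht
  have hgc : ContinuousAt g 0 := by
    have : ContinuousAt w (x + (0 : ℝ) • v) := by rw [hx0]; exact hw.continuousAt
    exact ContinuousAt.comp (f := fun t : ℝ => x + t • v) this (hline 0).continuousAt
  have hmax := isLocalMax_of_deriv_deriv_neg hneg hgmin.deriv_eq_zero hgc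
  have hconst : g =ᶠ[𝓝 0] fun _ => g 0 := by
    filter_upwards [hgmin, hmax] with t h1 h2
    exact le_antisymm h2 h1
  have h1 := hconst.deriv.deriv_eq
  simp at h1
  linarith

lemma psd_sum_nonneg {m : ℕ} (A H : Fin m → Fin m → ℝ) (hAs : ∀ i j, A i j = A j i)
    (hA : ∀ v : Fin m → ℝ, 0 ≤ ∑ i, ∑ j, A i j * v i * v j)
    (hH : ∀ v : Fin m → ℝ, 0 ≤ ∑ i, ∑ j, v i * v j * H i j) :
    0 ≤ ∑ i, ∑ j, A i j * H i j := by
  have hAp : (Matrix.of A).PosSemidef := by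
    refine Matrix.PosSemidef.of_dotProduct_mulVec_nonneg ?_ fun v => ?_
    · ext i j; simp [hAs i j]
    · refine (hA v).trans_eq ?_
      simp only [dotProduct, Matrix.mulVec, Matrix.of_apply, Finset.mul_sum, Pi.star_apply,
        star_trivial]
      exact Finset.sum_congr rfl fun i _ => Finset.sum_congr rfl fun j _ => by ring
  have hswap : ∀ F : Fin m → Fin m → ℝ, ∑ i, ∑ j, F i j = ∑ i, ∑ j, (F i j + F j i) / 2 := by
    intro F
    have : ∑ i, ∑ j, F j i = ∑ i, ∑ j, F i j := Finset.sum_comm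
    simp only [add_div, Finset.sum_add_distrib, ← Finset.sum_div, this]
    ring
  have hHp : (Matrix.of fun i j => (H i j + H j i) / 2).PosSemidef := by
    refine Matrix.PosSemidef.of_dotProduct_mulVec_nonneg ?_ fun v => ?_
    · ext i j; simp [add_comm]
    · refine (hH v).trans_eq ?_
      rw [hswap]
      simp only [dotProduct, Matrix.mulVec, Matrix.of_apply, Finset.mul_sum, Pi.star_apply,
        star_trivial]
      exact Finset.sum_congr rfl fun i _ => Finset.sum_congr rfl fun j _ => by ring
  have := (hAp.hadamard hHp).dotProduct_mulVec_nonneg (fun _ => (1 : ℝ))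
  refine this.trans_eq ?_
  rw [hswap]
  simp only [dotProduct, Matrix.mulVec, Matrix.of_apply, Finset.mul_sum, Pi.star_apply,
        star_trivial, Matrix.hadamard_apply]
  refine Finset.sum_congr rfl fun i _ => Finset.sum_congr rfl fun j _ => ?_
  rw [hAs j i]; ring

lemma Lop_nonneg_of_min {m : ℕ} {D : Set (Fin m → ℝ)}
    {a : (Fin m → ℝ) → Fin m → Fin m → ℝ} (b : (Fin m → ℝ) → Fin m → ℝ)
    (hell : UniformlyElliptic D a) {w : (Fin m → ℝ) → ℝ} {x : Fin m → ℝ} (hx : x ∈ D)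
    (hw : ContDiffAt ℝ 2 w x) (hmin : IsLocalMin w x) : 0 ≤ Lop a b w x := by
  obtain ⟨hs, lam, hlam, hl⟩ := hell
  have h0 : ∀ j, pd w j x = 0 := fun j => by simp [pd, hmin.fderiv_eq_zero]
  have h1 := psd_sum_nonneg (a x) (fun i j => pd2 w i j x) (hs x hx)
    (fun v => le_trans (by positivity) (hl x hx v)) (hess_nonneg hw hmin)
  simpa [Lop, h0] using h1

lemma pd_add_mul {m : ℕ} {f g : (Fin m → ℝ) → ℝ} {x : Fin m → ℝ} (c : ℝ)
    (hf : DifferentiableAt ℝ f x) (hg : DifferentiableAt ℝ g x) (j : Fin m) :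
    pd (fun y => f y + c * g y) j x = pd f j x + c * pd g j x := by
  have := (hf.hasFDerivAt.add (hg.hasFDerivAt.const_mul c)).fderiv
  unfold pd
  erw [this]
  simp

lemma Lop_add_mul {m : ℕ} (a : (Fin m → ℝ) → Fin m → Fin m → ℝ) (b : (Fin m → ℝ) → Fin m → ℝ)
    {f g : (Fin m → ℝ) → ℝ} {x : Fin m → ℝ} (c : ℝ)
    (hf : ContDiffAt ℝ 2 f x) (hg : ContDiffAt ℝ 2 g x) :
    Lop a b (fun y => f y + c * g y) x = Lop a b f x + c * Lop a b g x := by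
  have h1 : ∀ j, pd (fun y => f y + c * g y) j x = pd f j x + c * pd g j x := fun j =>
    pd_add_mul c (hf.differentiableAt (by norm_num)) (hg.differentiableAt (by norm_num)) j
  have h2 : ∀ i j, pd2 (fun y => f y + c * g y) i j x = pd2 f i j x + c * pd2 g i j x := by
    intro i j
    have he : pd (fun y => f y + c * g y) j =ᶠ[𝓝 x] fun y => pd f j y + c * pd g j y := by
      filter_upwards [ev_diff hf, ev_diff hg] with y h1 h2
      exact pd_add_mul c h1 h2 j
    have := pd_add_mul c (diff_pd hf j) (diff_pd hg j) i
    unfold pd2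
    change fderiv ℝ (pd (fun y => f y + c * g y) j) x _ = _
    rw [he.fderiv_eq]
    exact this
  simp only [Lop, h1, h2, mul_add, Finset.sum_add_distrib, Finset.mul_sum]
  have e1 : ∀ i j, a x i j * (c * pd2 g i j x) = c * (a x i j * pd2 g i j x) := fun i j => by ring
  have e2 : ∀ j, b x j * (c * pd g j x) = c * (b x j * pd g j x) := fun j => by ring
  simp only [e1, e2]
  ring

lemma Lop_sum {m n : ℕ} (a : (Fin m → ℝ) → Fin m → Fin m → ℝ) (b : (Fin m → ℝ) → Fin m → ℝ)
    {F : Fin n → (Fin m → ℝ) → ℝ} {x : Fin m → ℝ} (c : Fin n → ℝ)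
    (hF : ∀ i, ContDiffAt ℝ 2 (F i) x) (s : Finset (Fin n)) :
    Lop a b (fun y => ∑ i ∈ s, c i * F i y) x = ∑ i ∈ s, c i * Lop a b (F i) x := by
  induction s using Finset.induction_on with
  | empty => simp [Lop, pd, pd2]
  | insert k s hk ih =>
    simp only [Finset.sum_insert hk]
    rw [← ih, add_comm]
    rw [← Lop_add_mul a b (c k) (ContDiffAt.sum fun i _ => contDiffAt_const.mul (hF i)) (hF k)]
    congr 1; ext y; ring

lemma cone_functional {n : ℕ} (K : Set (Fin n → ℝ)) (hKc : IsClosed K) (hKconv : Convex ℝ K)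
    (hKcone : ∀ z ∈ K, ∀ t : ℝ, 0 ≤ t → t • z ∈ K)
    (hKstrict : StrictlyConvexAt K (0 : Fin n → ℝ)) (h0 : (0 : Fin n → ℝ) ∈ K) :
    ∃ l : (Fin n → ℝ) →L[ℝ] ℝ, ∃ c > 0, ∀ z ∈ K, c * ‖z‖ ≤ l z := by
  have hS : IsCompact (K ∩ Metric.sphere (0 : Fin n → ℝ) 1) :=
    (isCompact_sphere _ _).inter_left hKc
  have key : ∃ l : (Fin n → ℝ) →L[ℝ] ℝ, (∀ z ∈ K, 0 ≤ l z) ∧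
      ∀ z ∈ K ∩ Metric.sphere (0 : Fin n → ℝ) 1, z ∈ K → 0 < l z := by
    refine hS.induction_on (p := fun T => ∃ l : (Fin n → ℝ) →L[ℝ] ℝ, (∀ z ∈ K, 0 ≤ l z) ∧
      ∀ z ∈ T, z ∈ K → 0 < l z) ⟨0, by simp, by simp⟩ ?_ ?_ ?_
    · rintro s t hst ⟨l, h1, h2⟩
      exact ⟨l, h1, fun z hz => h2 z (hst hz)⟩
    · rintro s t ⟨l, h1, h2⟩ ⟨l', h1', h2'⟩
      refine ⟨l + l', fun z hz => add_nonneg (h1 z hz) (h1' z hz), ?_⟩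
      rintro z (hz | hz) hzK
      · exact add_pos_of_pos_of_nonneg (h2 z hz hzK) (h1' z hzK)
      · exact add_pos_of_nonneg_of_pos (h1 z hzK) (h2' z hz hzK)
    · rintro x ⟨hxK, hx1⟩
      have hx0 : x ≠ 0 := by rintro rfl; simp at hx1
      have hneg : -x ∉ K := by
        intro hn
        refine hKstrict x hxK (-x) hn ?_ (1/2) (by norm_num) (by norm_num) ?_
        · intro h; exact hx0 (self_eq_neg.1 h)
        · ext i; simp; ring
      obtain ⟨l, c, hlc, hl⟩ := geometric_hahn_banach_point_closed hKconv hKc hneg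
      have hc := hl 0 h0
      simp only [map_zero] at hc
      have hlx : 0 < l x := by simp only [map_neg] at hlc; linarith
      refine ⟨{z | 0 < l z}, mem_nhdsWithin_of_mem_nhds
        ((isOpen_lt continuous_const l.continuous).mem_nhds hlx), l, ?_, fun z hz _ => hz⟩
      intro z hz
      by_contra hzn
      push Not at hzn
      have := hl _ (hKcone z hz (c / l z) (div_nonneg_of_nonpos hc.le hzn.le))
      rw [map_smul, smul_eq_mul, div_mul_cancel₀ _ hzn.ne] at this
      exact lt_irrefl _ this
  obtain ⟨l, h1, h2⟩ := key
  obtain ⟨c, hc, hcl⟩ := hS.exists_forall_le' l.continuous.continuousOn (fun z hz => h2 z hz hz.1)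
  refine ⟨l, c, hc, fun z hz => ?_⟩
  rcases eq_or_ne z 0 with rfl | hz0
  · simp
  have hn : 0 < ‖z‖ := norm_pos_iff.2 hz0
  have := hcl (‖z‖⁻¹ • z) ⟨hKcone z hz _ (by positivity), by simp [norm_smul, hn.ne']⟩
  rw [map_smul, smul_eq_mul, inv_mul_eq_div, le_div_iff₀ hn] at this
  exact this

/-- squared Euclidean distance to `c`. -/
def qd {m : ℕ} (c x : Fin m → ℝ) : ℝ := ∑ k, (x k - c k) ^ 2

/-- barrier function. -/
def bar {m : ℕ} (c : Fin m → ℝ) (R α : ℝ) (x : Fin m → ℝ) : ℝ :=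
  (R - qd c x) + α * (R - qd c x) ^ 2

lemma qd_contDiff {m : ℕ} (c : Fin m → ℝ) : ContDiff ℝ 2 (qd c) := by
  unfold qd; fun_prop

lemma bar_contDiff {m : ℕ} (c : Fin m → ℝ) (R α : ℝ) : ContDiff ℝ 2 (bar c R α) := by
  have := qd_contDiff c
  unfold bar; fun_prop

lemma qd_hasFDerivAt {m : ℕ} (c x : Fin m → ℝ) :
    HasFDerivAt (qd c) (∑ k, (2 * (x k - c k)) •
      (ContinuousLinearMap.proj k : (Fin m → ℝ) →L[ℝ] ℝ)) x := by
  refine HasFDerivAt.fun_sum fun k _ => ?_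
  have h := ((ContinuousLinearMap.proj k : (Fin m → ℝ) →L[ℝ] ℝ).hasFDerivAt (x := x)).sub_const
    (c k)
  have := h.pow 2
  simpa using this

lemma pd_bar {m : ℕ} (c : Fin m → ℝ) (R α : ℝ) (j : Fin m) (x : Fin m → ℝ) :
    pd (bar c R α) j x = (1 + 2 * α * (R - qd c x)) * (-2 * (x j - c j)) := by
  have hs := (qd_hasFDerivAt c x).const_sub R
  have := (hs.add ((hs.pow 2).const_mul α)).fderiv
  unfold pd
  have e : bar c R α = (fun x => R - qd c x) + fun y => α * (R - qd c y) ^ 2 := rfl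
  rw [e, this]
  simp [Pi.single_apply]
  ring

lemma pd2_bar {m : ℕ} (c : Fin m → ℝ) (R α : ℝ) (i j : Fin m) (x : Fin m → ℝ) :
    pd2 (bar c R α) i j x = 8 * α * (x i - c i) * (x j - c j)
      + (1 + 2 * α * (R - qd c x)) * (if i = j then -2 else 0) := by
  have hs := (qd_hasFDerivAt c x).const_sub R
  have h1 := (hs.const_mul (2 * α)).const_add 1
  have h2 := (((ContinuousLinearMap.proj j : (Fin m → ℝ) →L[ℝ] ℝ).hasFDerivAt (x := x)).sub_const
    (c j)).const_mul (-2)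
  have h3 := (h1.mul h2).fderiv
  have e : (fun y => fderiv ℝ (bar c R α) y (Pi.single j 1)) =
    ((fun y => 1 + 2 * α * (R - qd c y)) * fun y => -2 * ((ContinuousLinearMap.proj j : (Fin m → ℝ) →L[ℝ] ℝ) y - c j)) := by
    ext y; exact pd_bar c R α j y
  unfold pd2
  rw [e, h3]
  by_cases hij : i = j
  · subst hij
    simp [Pi.single_apply]
    ring
  · simp [Pi.single_apply, hij, Ne.symm hij]
    ring

lemma Lop_bar_center {m : ℕ} {D : Set (Fin m → ℝ)} {a : (Fin m → ℝ) → Fin m → Fin m → ℝ}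
    (b : (Fin m → ℝ) → Fin m → ℝ) (hell : UniformlyElliptic D a) {c p : Fin m → ℝ} (hp : p ∈ D)
    (hR : 0 < qd c p) : ∃ α : ℝ, 0 < Lop a b (bar c (qd c p) α) p := by
  obtain ⟨hs, lam, hlam, hl⟩ := hell
  have h := hl p hp (fun k => p k - c k)
  change lam * qd c p ≤ _ at h
  set Q := ∑ i, ∑ j, a p i j * (p i - c i) * (p j - c j) with hQ
  have hQ0 : 0 < Q := lt_of_lt_of_le (mul_pos hlam hR) h
  set M := ∑ i, ∑ j, a p i j * (if i = j then -2 else 0) + ∑ j, b p j * (-2 * (p j - c j)) with hM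
  have e : ∀ α, Lop a b (bar c (qd c p) α) p = 8 * α * Q + M := by
    intro α
    simp only [Lop, pd_bar, pd2_bar, sub_self, mul_zero, add_zero, one_mul, mul_add,
      Finset.sum_add_distrib, hQ, hM, Finset.mul_sum]
    rw [add_assoc]
    congr 1
    exact Finset.sum_congr rfl fun i _ => Finset.sum_congr rfl fun j _ => by ring
  refine ⟨(1 - M) / (8 * Q), ?_⟩
  rw [e]
  have : 8 * ((1 - M) / (8 * Q)) * Q = 1 - M := by field_simp
  linarith

lemma Lop_bar_cont {m : ℕ} {D : Set (Fin m → ℝ)} (hD : IsOpen D)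
    {a : (Fin m → ℝ) → Fin m → Fin m → ℝ}
    {b : (Fin m → ℝ) → Fin m → ℝ} (hacont : ∀ i j, ContinuousOn (fun x => a x i j) D)
    (hbcont : ∀ j, ContinuousOn (fun x => b x j) D) (c : Fin m → ℝ) (R α : ℝ) {p : Fin m → ℝ}
    (hp : p ∈ D) : ContinuousAt (Lop a b (bar c R α)) p := by
  have hq := (qd_contDiff c).continuous
  have e : Lop a b (bar c R α) = fun x => (∑ i, ∑ j, a x i j * (8 * α * (x i - c i) * (x j - c j)
      + (1 + 2 * α * (R - qd c x)) * (if i = j then -2 else 0))) +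
      ∑ j, b x j * ((1 + 2 * α * (R - qd c x)) * (-2 * (x j - c j))) := by
    ext x; simp only [Lop, pd_bar, pd2_bar]
  have ha : ∀ i j, ContinuousAt (fun x => a x i j) p := fun i j =>
    (hacont i j).continuousAt (hD.mem_nhds hp)
  have hb : ∀ j, ContinuousAt (fun x => b x j) p := fun j =>
    (hbcont j).continuousAt (hD.mem_nhds hp)
  rw [e]
  refine ContinuousAt.add ?_ ?_
  · refine tendsto_finsetSum _ fun i _ => tendsto_finsetSum _ fun j _ => ?_
    refine (ha i j).mul (Continuous.continuousAt ?_)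
    fun_prop
  · refine tendsto_finsetSum _ fun j _ => ?_
    refine (hb j).mul (Continuous.continuousAt ?_)
    fun_prop

lemma hopf {m : ℕ} {D U : Set (Fin m → ℝ)} (hD : IsOpen D) (hU : IsOpen U) (hUD : U ⊆ D)
    {a : (Fin m → ℝ) → Fin m → Fin m → ℝ} {b : (Fin m → ℝ) → Fin m → ℝ}
    (hell : UniformlyElliptic D a)
    (hacont : ∀ i j, ContinuousOn (fun x => a x i j) D)
    (hbcont : ∀ j, ContinuousOn (fun x => b x j) D)
    {f : (Fin m → ℝ) → ℝ} (hf : ∀ x ∈ U, ContDiffAt ℝ 2 f x) (hf0 : ∀ x ∈ U, 0 ≤ f x)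
    {C : ℝ} (hC : 0 ≤ C) (hL : ∀ x ∈ U, Lop a b f x ≤ C * f x)
    {c p : Fin m → ℝ} (hp : p ∈ U) (hfp : f p = 0) (hR : 0 < qd c p)
    (hpos : ∀ x ∈ U, qd c x ≤ qd c p → x ≠ p → 0 < f x) : False := by
  obtain ⟨α, hα⟩ := Lop_bar_center b hell (hUD hp) hR
  set h := bar c (qd c p) α with hh
  have hhp : h p = 0 := by simp [hh, bar]
  have hhc : Continuous h := (bar_contDiff c _ α).continuous
  have hqc := (qd_contDiff c).continuous
  have ev1 : ∀ᶠ x in 𝓝 p, 0 < Lop a b h x - C * h x := by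
    have : ContinuousAt (fun x => Lop a b h x - C * h x) p :=
      (Lop_bar_cont hD hacont hbcont c _ α (hUD hp)).sub
        (continuousAt_const.mul hhc.continuousAt)
    refine this.eventually (lt_mem_nhds ?_)
    simpa [hhp] using hα
  have ev2 : ∀ᶠ x in 𝓝 p, 0 < 1 + α * (qd c p - qd c x) := by
    have : Continuous (fun x => 1 + α * (qd c p - qd c x)) := by fun_prop
    refine this.continuousAt.eventually (lt_mem_nhds ?_)
    simp
  obtain ⟨ρ, hρ, hball⟩ := Metric.nhds_basis_closedBall.eventually_iff.1
    (ev1.and (ev2.and (hU.mem_nhds hp)))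
  have hfc : ContinuousOn f U := fun x hx => (hf x hx).continuousAt.continuousWithinAt
  have hballU : Metric.closedBall p ρ ⊆ U := fun x hx => (hball hx).2.2
  have hT : IsCompact (Metric.sphere p ρ ∩ {x | qd c x ≤ qd c p}) :=
    (isCompact_sphere p ρ).inter_right (isClosed_le hqc continuous_const)
  obtain ⟨ε, hε, hεT⟩ := hT.exists_forall_le' (f := fun x => f x / (|h x| + 1)) (a := 0)
    (by
      refine ContinuousOn.div (hfc.mono ?_) (by fun_prop) (fun x _ => by positivity)
      exact fun x hx => hballU (Metric.sphere_subset_closedBall hx.1))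
    (by
      rintro x ⟨hx1, hx2⟩
      refine div_pos (hpos x (hballU (Metric.sphere_subset_closedBall hx1)) hx2 ?_) (by positivity)
      rintro rfl
      simp at hx1
      exact hρ.ne hx1)
  set w : (Fin m → ℝ) → ℝ := fun x => f x + (-ε) * h x with hw
  have hwp : w p = 0 := by simp [hw, hfp, hhp]
  have hwsph : ∀ x ∈ Metric.sphere p ρ, 0 ≤ w x := by
    intro x hx
    have hxb := Metric.sphere_subset_closedBall hx
    by_cases hq : qd c x ≤ qd c p
    · have := hεT x ⟨hx, hq⟩
      rw [le_div_iff₀ (by positivity)] at this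
      have h2 := le_abs_self (h x)
      simp only [hw]
      nlinarith
    · push Not at hq
      have h1 := (hball hxb).2.1
      have h2 : h x ≤ 0 := by
        have : h x = (qd c p - qd c x) * (1 + α * (qd c p - qd c x)) := by
          simp only [hh, bar]; ring
        rw [this]
        exact mul_nonpos_of_nonpos_of_nonneg (by linarith) h1.le
      have h3 := hf0 x (hballU hxb)
      simp only [hw]
      nlinarith
  have hwc : ContinuousOn w (Metric.closedBall p ρ) := (hfc.mono hballU).add (by fun_prop)
  -- no interior minimum with nonpositive value
  have hno : ∀ x ∈ Metric.ball p ρ, IsMinOn w (Metric.closedBall p ρ) x → w x ≤ 0 → False := by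
    intro x hx hmin hle
    have hxb := Metric.ball_subset_closedBall hx
    have hxU := hballU hxb
    have hloc : IsLocalMin w x := hmin.isLocalMin
      (mem_of_superset (Metric.isOpen_ball.mem_nhds hx) Metric.ball_subset_closedBall)
    have hhx : ContDiffAt ℝ 2 h x := (bar_contDiff c _ α).contDiffAt
    have h1 := Lop_nonneg_of_min b hell (hUD hxU)
      ((hf x hxU).add (contDiffAt_const.mul hhx) : ContDiffAt ℝ 2 w x) hloc
    rw [Lop_add_mul a b (-ε) (hf x hxU) hhx] at h1
    have h2 := hL x hxU
    have h3 := (hball hxb).1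
    have h4 : C * (f x + (-ε) * h x) ≤ 0 := mul_nonpos_of_nonneg_of_nonpos hC hle
    nlinarith [mul_pos hε h3]
  obtain ⟨x, hx, hmin⟩ := (isCompact_closedBall p ρ).exists_isMinOn
    ⟨p, Metric.mem_closedBall_self hρ.le⟩ hwc
  by_cases hneg : w x < 0
  · refine hno x ?_ hmin hneg.le
    rcases (Metric.mem_closedBall.1 hx).lt_or_eq with h | h
    · exact h
    · exact absurd (hwsph x h) (not_le.2 hneg)
  · push Not at hneg
    refine hno p (Metric.mem_ball_self hρ) (fun y hy => ?_) hwp.le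
    change w p ≤ w y
    rw [hwp]
    exact hneg.trans (hmin hy)

lemma strong_local {m : ℕ} {D : Set (Fin m → ℝ)} (hD : IsOpen D) 
    {a : (Fin m → ℝ) → Fin m → Fin m → ℝ} {b : (Fin m → ℝ) → Fin m → ℝ}
    (hell : UniformlyElliptic D a)
    (hacont : ∀ i j, ContinuousOn (fun x => a x i j) D)
    (hbcont : ∀ j, ContinuousOn (fun x => b x j) D)
    {f : (Fin m → ℝ) → ℝ} {z : Fin m → ℝ} {δ : ℝ} (hδ : 0 < δ) (hUD : Metric.ball z δ ⊆ D)
    (hf : ∀ x ∈ Metric.ball z δ, ContDiffAt ℝ 2 f x) (hf0 : ∀ x ∈ Metric.ball z δ, 0 ≤ f x)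
    {C : ℝ} (hC : 0 ≤ C) (hL : ∀ x ∈ Metric.ball z δ, Lop a b f x ≤ C * f x)
    (hfz : f z = 0) : ∀ᶠ y in 𝓝 z, f y = 0 := by
  set r := δ / 2 / (m + 2) with hr
  have hr0 : 0 < r := by positivity
  have hrm : (m + 2) * r = δ / 2 := by rw [hr]; field_simp
  have hrδ : r ≤ δ / 2 := by
    rw [← hrm]
    have : (0 : ℝ) ≤ m := Nat.cast_nonneg m
    nlinarith
  filter_upwards [Metric.ball_mem_nhds z hr0] with y hy
  by_contra hfy
  have hsub : Metric.closedBall z (δ / 2) ⊆ Metric.ball z δ :=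
    Metric.closedBall_subset_ball (by linarith)
  have hfc : ContinuousOn f (Metric.closedBall z (δ / 2)) := fun x hx =>
    (hf x (hsub hx)).continuousAt.continuousWithinAt
  have hcomp : IsCompact (Metric.closedBall z (δ / 2) ∩ f ⁻¹' {0}) :=
    (isCompact_closedBall _ _).of_isClosed_subset
      (hfc.preimage_isClosed_of_isClosed Metric.isClosed_closedBall isClosed_singleton)
      inter_subset_left
  have hzmem : z ∈ Metric.closedBall z (δ / 2) ∩ f ⁻¹' {0} :=
    ⟨Metric.mem_closedBall_self (by linarith), hfz⟩
  have hqc := (qd_contDiff y).continuous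
  obtain ⟨p, ⟨hpb, hfp⟩, hpmin⟩ := hcomp.exists_isMinOn ⟨z, hzmem⟩ hqc.continuousOn
  have hfp : f p = 0 := hfp
  have hqz : qd y p ≤ m * r ^ 2 := by
    refine (hpmin hzmem).trans ?_
    change ∑ k, (z k - y k) ^ 2 ≤ _
    refine (Finset.sum_le_card_nsmul Finset.univ _ (r ^ 2) fun k _ => ?_).trans_eq (by simp)
    have hzy : dist z y ≤ r := by rw [dist_comm]; exact (Metric.mem_ball.1 hy).le
    have := (dist_le_pi_dist z y k).trans hzy
    rw [Real.dist_eq] at this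
    exact sq_le_sq' (abs_le.1 this).1 (abs_le.1 this).2
  have hin : ∀ x, qd y x < qd y p → x ∈ Metric.ball z δ → 0 < f x := by
    intro x hx hxb
    refine lt_of_le_of_ne (hf0 x hxb) fun h0 => ?_
    have hxc : x ∈ Metric.closedBall z (δ / 2) := by
      have h1 : dist x y ≤ (m + 1) * r := by
        refine (dist_pi_le_iff (by positivity)).2 fun k => ?_
        rw [Real.dist_eq]
        refine abs_le_of_sq_le_sq ?_ (by positivity)
        have h2 : (x k - y k) ^ 2 ≤ qd y x :=
          Finset.single_le_sum (f := fun k => (x k - y k) ^ 2) (fun i _ => sq_nonneg _)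
            (Finset.mem_univ k)
        have : (0 : ℝ) ≤ m := Nat.cast_nonneg m
        nlinarith [sq_nonneg r, mul_nonneg this (sq_nonneg r),
          mul_nonneg (mul_nonneg this this) (sq_nonneg r)]
      have h2 := dist_triangle x y z
      have h3 : dist y z < r := hy
      rw [Metric.mem_closedBall]
      nlinarith
    exact absurd (hpmin (show x ∈ Metric.closedBall z (δ / 2) ∩ f ⁻¹' {0} from ⟨hxc, h0.symm⟩))
      (not_le.2 hx)
  have hpy : p ≠ y := by rintro rfl; exact hfy hfp
  have qpos : ∀ c x : Fin m → ℝ, x ≠ c → 0 < qd c x := by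
    intro c x hx
    obtain ⟨k, hk⟩ := Function.ne_iff.1 hx
    exact Finset.sum_pos' (fun i _ => sq_nonneg _)
      ⟨k, Finset.mem_univ k, by have := sub_ne_zero.2 hk; positivity⟩
  set c : Fin m → ℝ := fun k => (y k + p k) / 2 with hc
  have hpar : ∀ x, qd y x + qd p x = 2 * qd c x + qd y p / 2 := by
    intro x
    simp only [qd, hc, Finset.mul_sum, Finset.sum_div, ← Finset.sum_add_distrib]
    exact Finset.sum_congr rfl fun k _ => by ring
  have hpp : qd p p = 0 := by simp [qd]
  have hcp : qd c p = qd y p / 4 := by have := hpar p; rw [hpp] at this; linarith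
  have hyp := qpos y p hpy
  refine hopf hD Metric.isOpen_ball hUD hell hacont hbcont hf hf0 hC hL (hsub hpb) hfp
    (c := c) (by rw [hcp]; linarith) ?_
  intro x hx hq hxp
  refine hin x ?_ hx
  have := hpar x
  have := qpos p x hxp
  linarith

/-- **Vanishing principle for cones.**  Let `K ⊆ ℝⁿ` be a closed convex cone with vertex `0`
that is strictly convex at `0`.  If a `C²` map `u : D → K` solves `Lu + Ψ(·, u) = 0` on the
open connected set `D`, with `L` uniformly elliptic with continuous coefficients, `Ψ`
continuous, locally Lipschitz in the second variable and inward pointing on `∂K`, and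
`u(x₀) = 0` for some `x₀ ∈ D`, then `u` vanishes identically on `D`. -/
theorem cone_vanishing_principle
    (m n : ℕ) (D : Set (Fin m → ℝ)) (hDo : IsOpen D) (hDc : IsConnected D)
    (K : Set (Fin n → ℝ)) (hKc : IsClosed K) (hKconv : Convex ℝ K)
    (hKcone : ∀ z ∈ K, ∀ t : ℝ, 0 ≤ t → t • z ∈ K)
    (hKstrict : StrictlyConvexAt K (0 : Fin n → ℝ))
    (a : (Fin m → ℝ) → Fin m → Fin m → ℝ) (b : (Fin m → ℝ) → Fin m → ℝ)
    (hell : UniformlyElliptic D a)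
    (hacont : ∀ i j, ContinuousOn (fun x => a x i j) D)
    (hbcont : ∀ j, ContinuousOn (fun x => b x j) D)
    (Ψ : (Fin m → ℝ) → (Fin n → ℝ) → (Fin n → ℝ))
    (hΨcont : ContinuousOn (fun p : (Fin m → ℝ) × (Fin n → ℝ) => Ψ p.1 p.2)
      (D ×ˢ (Set.univ : Set (Fin n → ℝ))))
    (hΨlip : ∀ x₀ ∈ D, ∀ y₀ : Fin n → ℝ, ∃ ε > (0 : ℝ), ∃ C : ℝ,
      ∀ x ∈ D, dist x x₀ < ε → ∀ y₁ y₂ : Fin n → ℝ, dist y₁ y₀ < ε → dist y₂ y₀ < ε →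
        dist (Ψ x y₁) (Ψ x y₂) ≤ C * dist y₁ y₂)
    (hΨin : ∀ x ∈ D, ∀ y ∈ frontier K, PointsInto K y (Ψ x y))
    (u : (Fin m → ℝ) → (Fin n → ℝ))
    (hu : ∀ i, ContDiffOn ℝ 2 (fun x => u x i) D)
    (huK : ∀ x ∈ D, u x ∈ K)
    (heq : ∀ x ∈ D, ∀ i, Lop a b (fun y => u y i) x + Ψ x (u x) i = 0)
    (x₀ : Fin m → ℝ) (hx₀ : x₀ ∈ D) (hzero : u x₀ = 0) :
    ∀ x ∈ D, u x = 0 := by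
  have h0K : (0 : Fin n → ℝ) ∈ K := hzero ▸ huK x₀ hx₀
  rcases isEmpty_or_nonempty (Fin n) with hn | hn
  · intro x _
    exact Subsingleton.elim _ _
  have hfr : (0 : Fin n → ℝ) ∈ frontier K := by
    rw [frontier, hKc.closure_eq]
    refine ⟨h0K, fun hint => ?_⟩
    obtain ⟨ε, hε, hball⟩ := Metric.mem_nhds_iff.1 (mem_interior_iff_mem_nhds.1 hint)
    set e : Fin n → ℝ := fun _ => ε / 2 with he
    have hnorm : ‖e‖ < ε := by
      rw [he, pi_norm_const, Real.norm_eq_abs, abs_of_pos (by positivity)]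
      linarith
    have h1 : e ∈ K := hball (by simpa using hnorm)
    have h2 : -e ∈ K := hball (by simpa using hnorm)
    refine hKstrict e h1 (-e) h2 ?_ (1 / 2) (by norm_num) (by norm_num) ?_
    · intro h
      have := congrFun h hn.some
      simp only [he, Pi.neg_apply] at this
      linarith
    · ext i
      simp
      try ring
  obtain ⟨l, c, hc, hl⟩ := cone_functional K hKc hKconv hKcone hKstrict h0K
  set ξ : Fin n → ℝ := fun i => l (Pi.single i 1) with hξ
  have hlsum : ∀ z, l z = ∑ i, ξ i * z i := fun z => by
    rw [clm_apply_eq_sum]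
    exact Finset.sum_congr rfl fun i _ => mul_comm _ _
  have hΨ0 : ∀ x ∈ D, 0 ≤ l (Ψ x 0) := by
    intro x hx
    rw [hlsum]
    refine hΨin x hx 0 hfr ξ fun z hz => ?_
    have := (mul_nonneg hc.le (norm_nonneg z)).trans (hl z hz)
    rw [hlsum] at this
    simpa using this
  set f : (Fin m → ℝ) → ℝ := fun x => ∑ i, ξ i * u x i with hf
  have hfl : ∀ x, f x = l (u x) := fun x => (hlsum _).symm
  have hf0 : ∀ x ∈ D, 0 ≤ f x := fun x hx => by
    rw [hfl]; exact (mul_nonneg hc.le (norm_nonneg _)).trans (hl _ (huK x hx))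
  have hfu : ∀ x ∈ D, f x = 0 → u x = 0 := by
    intro x hx h
    have := hl _ (huK x hx)
    rw [← hfl, h] at this
    have h2 := norm_nonneg (u x)
    exact norm_eq_zero.1 (le_antisymm (by nlinarith) h2)
  have huC : ∀ x ∈ D, ∀ i, ContDiffAt ℝ 2 (fun y => u y i) x := fun x hx i =>
    (hu i).contDiffAt (hDo.mem_nhds hx)
  have hfC : ∀ x ∈ D, ContDiffAt ℝ 2 f x := fun x hx =>
    ContDiffAt.sum fun i _ => contDiffAt_const.mul (huC x hx i)
  have hucont : ∀ x ∈ D, ContinuousAt u x := fun x hx =>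
    continuousAt_pi.2 fun i => (huC x hx i).continuousAt
  have hLf : ∀ x ∈ D, Lop a b f x = - l (Ψ x (u x)) := by
    intro x hx
    rw [hf, Lop_sum a b ξ (huC x hx) Finset.univ, hlsum, ← Finset.sum_neg_distrib]
    refine Finset.sum_congr rfl fun i _ => ?_
    have := heq x hx i
    rw [show Lop a b (fun y => u y i) x = - Ψ x (u x) i by linarith]
    ring
  have hopen : ∀ z ∈ D, u z = 0 → ∀ᶠ y in 𝓝 z, u y = 0 := by
    intro z hz huz
    obtain ⟨ε, hε, C, hlip⟩ := hΨlip z hz 0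
    have ev : ∀ᶠ x in 𝓝 z, x ∈ D ∧ dist x z < ε ∧ dist (u x) 0 < ε := by
      have := (hucont z hz).eventually (Metric.ball_mem_nhds _ hε)
      rw [huz] at this
      filter_upwards [hDo.mem_nhds hz, Metric.ball_mem_nhds z hε, this] with x h1 h2 h3
      exact ⟨h1, h2, h3⟩
    obtain ⟨δ, hδ, hb⟩ := Metric.nhds_basis_ball.eventually_iff.1 ev
    have hL : ∀ x ∈ Metric.ball z δ, Lop a b f x ≤ (‖l‖ * |C| / c) * f x := by
      intro x hx
      obtain ⟨hxD, hxz, hux⟩ := hb hx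
      rw [hLf x hxD]
      have h1 := hlip x hxD hxz 0 (u x) (by simpa using hε) hux
      rw [dist_eq_norm, dist_eq_norm, zero_sub, norm_neg] at h1
      have h2 : l (Ψ x 0) - l (Ψ x (u x)) ≤ ‖l‖ * ‖Ψ x 0 - Ψ x (u x)‖ := by
        rw [← map_sub]
        exact (le_abs_self _).trans (l.le_opNorm _)
      have h3 : ‖Ψ x 0 - Ψ x (u x)‖ ≤ |C| * ‖u x‖ :=
        h1.trans (mul_le_mul_of_nonneg_right (le_abs_self C) (norm_nonneg _))
      have h4 : ‖u x‖ ≤ f x / c := by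
        rw [le_div_iff₀ hc, hfl, mul_comm]
        exact hl _ (huK x hxD)
      have h5 := hΨ0 x hxD
      calc - l (Ψ x (u x)) ≤ ‖l‖ * ‖Ψ x 0 - Ψ x (u x)‖ := by linarith
        _ ≤ ‖l‖ * (|C| * (f x / c)) := by gcongr; exact h3.trans (by gcongr)
        _ = _ := by ring
    have hfz : f z = 0 := by rw [hfl, huz, map_zero]
    have := strong_local hDo hell hacont hbcont hδ (fun x hx => (hb hx).1)
      (fun x hx => hfC x (hb hx).1) (fun x hx => hf0 x (hb hx).1)
      (by positivity : 0 ≤ ‖l‖ * |C| / c) hL hfz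
    filter_upwards [this, hDo.mem_nhds hz] with y hy hyD
    exact hfu y hyD hy
  have hZopen : IsOpen (D ∩ {x | u x = 0}) := by
    rw [isOpen_iff_mem_nhds]
    rintro z ⟨hz, huz⟩
    exact inter_mem (hDo.mem_nhds hz) (hopen z hz huz)
  have hsub : D ⊆ D ∩ {x | u x = 0} := by
    refine hDc.isPreconnected.subset_of_closure_inter_subset hZopen ⟨x₀, hx₀, hx₀, hzero⟩ ?_
    rintro x ⟨hxc, hxD⟩
    refine ⟨hxD, ?_⟩
    by_contra hne
    have : ∀ᶠ y in 𝓝 x, u y ≠ 0 := (hucont x hxD).eventually_ne hne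
    obtain ⟨y, hy1, hy2⟩ := mem_closure_iff_nhds.1 hxc _ this
    exact hy1 hy2.2
  exact fun x hx => (hsub hx).2
end

section
/- Let D ⊆ ℝ^m be an open connected set, L a uniformly elliptic second-order operator on D with continuous coefficients, and Ψ a smooth map from the space of symmetric n×n real matrices to itself satisfying the null-eigenvector condition. Suppose φ : D → Sym(n, ℝ) is a smooth map such that φ(x) is positive semidefinite for every x ∈ D and (Lφ)(x) + Ψ(φ(x)) = 0 for all x ∈ D (L acting entrywise). If φ(x₀) has a zero eigenvalue (equivalently, det φ(x₀) = 0) at some point x₀ ∈ D, then φ(x) has a zero eigenvalue at every x ∈ D. If moreover φ(x₀) = 0 at some x₀ ∈ D, then φ vanishes identically on D. -/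
/-- The quadratic form `vᵀ θ v` of an `n × n` matrix `θ` (given as `Fin n → Fin n → ℝ`). -/
def quadForm {n : ℕ} (θ : Fin n → Fin n → ℝ) (v : Fin n → ℝ) : ℝ :=
  ∑ i, ∑ j, v i * θ i j * v j

/-- `Ψ` (mapping symmetric matrices to symmetric matrices) satisfies Hamilton's
null-eigenvector condition: whenever `θ` is a positive semidefinite symmetric matrix and
`v` is a null-eigenvector of `θ`, then `vᵀ Ψ(θ) v ≥ 0`. -/
def NullEigenvectorCondition {n : ℕ} (Ψ : (Fin n → Fin n → ℝ) → (Fin n → Fin n → ℝ)) : Prop :=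
  ∀ θ : Fin n → Fin n → ℝ, (∀ i j, θ i j = θ j i) → (∀ v, 0 ≤ quadForm θ v) →
    ∀ v : Fin n → ℝ, quadForm θ v = 0 → 0 ≤ quadForm (Ψ θ) v

open Filter Topology

lemma smp_pd2_eq {m : ℕ} {u : (Fin m → ℝ) → ℝ} {x : Fin m → ℝ} (hu : ContDiffAt ℝ 2 u x)
    (i j : Fin m) :
    pd2 u i j x = fderiv ℝ (fderiv ℝ u) x (Pi.single i 1) (Pi.single j 1) := by
  have h1 : ContDiffAt ℝ 1 (fderiv ℝ u) x := hu.fderiv_right (by norm_num)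
  have h2 : DifferentiableAt ℝ (fderiv ℝ u) x := h1.differentiableAt (by norm_num)
  unfold pd2
  rw [fderiv_clm_apply h2 (differentiableAt_const _)]
  simp

lemma smp_Lop_add {m : ℕ} (a : (Fin m → ℝ) → Fin m → Fin m → ℝ) (b : (Fin m → ℝ) → Fin m → ℝ)
    {u w : (Fin m → ℝ) → ℝ} {x : Fin m → ℝ}
    (hu : ContDiffAt ℝ 2 u x) (hw : ContDiffAt ℝ 2 w x) :
    Lop a b (fun y => u y + w y) x = Lop a b u x + Lop a b w x := by
  have hev : fderiv ℝ (fun y => u y + w y) =ᶠ[𝓝 x] fun y => fderiv ℝ u y + fderiv ℝ w y := by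
    filter_upwards [hu.eventually (by simp), hw.eventually (by simp)] with y h1 h2
    exact fderiv_fun_add (h1.differentiableAt (by norm_num)) (h2.differentiableAt (by norm_num))
  have h1 : ContDiffAt ℝ 1 (fderiv ℝ u) x := hu.fderiv_right (by norm_num)
  have h2 : ContDiffAt ℝ 1 (fderiv ℝ w) x := hw.fderiv_right (by norm_num)
  have e2 : fderiv ℝ (fderiv ℝ (fun y => u y + w y)) x
      = fderiv ℝ (fderiv ℝ u) x + fderiv ℝ (fderiv ℝ w) x := by
    rw [hev.fderiv_eq]
    exact fderiv_fun_add (h1.differentiableAt (by norm_num)) (h2.differentiableAt (by norm_num))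
  have e1 := hev.self_of_nhds
  unfold Lop
  simp only [smp_pd2_eq hu, smp_pd2_eq hw, smp_pd2_eq (hu.add hw), e2, pd, e1,
    _root_.add_apply, mul_add, Finset.sum_add_distrib]
  ring

lemma smp_Lop_const_mul {m : ℕ} (a : (Fin m → ℝ) → Fin m → Fin m → ℝ)
    (b : (Fin m → ℝ) → Fin m → ℝ)
    {u : (Fin m → ℝ) → ℝ} {x : Fin m → ℝ} (c : ℝ)
    (hu : ContDiffAt ℝ 2 u x) :
    Lop a b (fun y => c * u y) x = c * Lop a b u x := by
  have hev : fderiv ℝ (fun y => c * u y) =ᶠ[𝓝 x] fun y => c • fderiv ℝ u y := by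
    filter_upwards [hu.eventually (by simp)] with y h1
    exact fderiv_const_mul (h1.differentiableAt (by norm_num)) c
  have h1 : ContDiffAt ℝ 1 (fderiv ℝ u) x := hu.fderiv_right (by norm_num)
  have e2 : fderiv ℝ (fderiv ℝ (fun y => c * u y)) x = c • fderiv ℝ (fderiv ℝ u) x := by
    rw [hev.fderiv_eq]
    exact fderiv_fun_const_smul (h1.differentiableAt (by norm_num)) c
  have e1 := hev.self_of_nhds
  unfold Lop
  simp only [smp_pd2_eq hu, smp_pd2_eq (contDiffAt_const.mul hu), e2, pd, e1,
    _root_.smul_apply, smul_eq_mul, mul_add, Finset.mul_sum]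
  congr 1
  · refine Finset.sum_congr rfl fun i _ => Finset.sum_congr rfl fun j _ => by ring
  · refine Finset.sum_congr rfl fun i _ => by ring

lemma smp_Lop_sum {m : ℕ} {ι : Type*} (a : (Fin m → ℝ) → Fin m → Fin m → ℝ)
    (b : (Fin m → ℝ) → Fin m → ℝ) (s : Finset ι)
    (u : ι → (Fin m → ℝ) → ℝ) {x : Fin m → ℝ}
    (hu : ∀ k, ContDiffAt ℝ 2 (u k) x) :
    Lop a b (fun y => ∑ k ∈ s, u k y) x = ∑ k ∈ s, Lop a b (u k) x := by
  classical
  induction s using Finset.induction_on with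
  | empty => simp [Lop, pd, pd2]
  | insert k s hk ih =>
    simp only [Finset.sum_insert hk]
    rw [smp_Lop_add a b (hu k) (ContDiffAt.sum fun k _ => hu k), ih]

lemma smp_hess {m : ℕ} {h : (Fin m → ℝ) → ℝ} {p : Fin m → ℝ} (hh : ContDiffAt ℝ 2 h p)
    (hmin : IsLocalMin h p) (ξ : Fin m → ℝ) :
    0 ≤ ∑ i, ∑ j, ξ i * ξ j * pd2 h i j p := by
  have hsum : ∑ i, ∑ j, ξ i * ξ j * pd2 h i j p = fderiv ℝ (fderiv ℝ h) p ξ ξ := by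
    simp only [smp_pd2_eq hh]
    have hξ : ξ = ∑ i, ξ i • (Pi.single i 1 : Fin m → ℝ) := by
      ext k; simp [Finset.sum_apply, Pi.single_apply]
    conv_rhs => rw [hξ]
    simp only [map_sum, map_smul, _root_.sum_apply, _root_.smul_apply,
      smul_eq_mul, Finset.mul_sum]
    rw [Finset.sum_comm]
    refine Finset.sum_congr rfl fun i _ => Finset.sum_congr rfl fun j _ => by ring
  rw [hsum]
  by_contra! hneg
  set g : ℝ → ℝ := fun t => h (p + t • ξ) with hg
  have hline : ∀ t : ℝ, HasDerivAt (fun t : ℝ => p + t • ξ) ξ t := fun t => by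
    simpa using ((hasDerivAt_id t).smul_const ξ).const_add p
  have hc : Tendsto (fun t : ℝ => p + t • ξ) (𝓝 0) (𝓝 p) := by
    have := (hline 0).continuousAt.tendsto
    simpa using this
  have hd : deriv g =ᶠ[𝓝 0] fun t => fderiv ℝ h (p + t • ξ) ξ := by
    filter_upwards [hc.eventually (hh.eventually (by simp))] with t ht
    exact ((ht.differentiableAt (by norm_num)).hasFDerivAt.comp_hasDerivAt t (hline t)).deriv
  have h1 : ContDiffAt ℝ 1 (fderiv ℝ h) p := hh.fderiv_right (by norm_num)
  have h2 : HasFDerivAt (fderiv ℝ h) (fderiv ℝ (fderiv ℝ h) p) (p + (0:ℝ) • ξ) := by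
    simpa using (h1.differentiableAt (by norm_num)).hasFDerivAt
  have h3 := h2.comp_hasDerivAt 0 (hline 0)
  have h4 : HasDerivAt (fun t : ℝ => fderiv ℝ h (p + t • ξ) ξ) (fderiv ℝ (fderiv ℝ h) p ξ ξ) 0 := by
    have := h3.clm_apply (hasDerivAt_const 0 ξ)
    simpa using this
  have hdd : deriv (deriv g) 0 = fderiv ℝ (fderiv ℝ h) p ξ ξ := by
    rw [hd.deriv_eq]; exact h4.deriv
  have gmin : IsLocalMin g 0 := by
    have := hc.eventually hmin
    filter_upwards [this] with t ht
    simpa [hg] using ht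
  have gcont : ContinuousAt g 0 := by
    have : ContinuousAt h (p + (0:ℝ) • ξ) := by simpa using hh.continuousAt
    exact ContinuousAt.comp this (hline 0).continuousAt
  have gmax : IsLocalMax g 0 :=
    isLocalMax_of_deriv_deriv_neg (by rw [hdd]; exact hneg) gmin.deriv_eq_zero gcont
  have geq : g =ᶠ[𝓝 0] fun _ => g 0 := by
    filter_upwards [gmin, gmax] with t h5 h6 using le_antisymm h6 h5
  have : deriv g =ᶠ[𝓝 0] fun _ => 0 := by
    have := geq.deriv
    simpa using this
  have h7 : deriv (deriv g) 0 = 0 := by rw [this.deriv_eq]; simp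
  linarith

lemma smp_Lop_min {m : ℕ} (a : (Fin m → ℝ) → Fin m → Fin m → ℝ)
    (b : (Fin m → ℝ) → Fin m → ℝ) {h : (Fin m → ℝ) → ℝ} {p : Fin m → ℝ}
    (hh : ContDiffAt ℝ 2 h p) (hmin : IsLocalMin h p)
    (hsym : ∀ i j, a p i j = a p j i) (hpos : ∀ ξ : Fin m → ℝ, 0 ≤ ∑ i, ∑ j, a p i j * ξ i * ξ j) :
    0 ≤ Lop a b h p := by
  have hA : (Matrix.of (a p)).PosSemidef := by
    refine Matrix.PosSemidef.of_dotProduct_mulVec_nonneg ?_ ?_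
    · ext i j; simp [hsym i j]
    · intro ξ
      refine (hpos ξ).trans_eq ?_
      simp only [dotProduct, Matrix.mulVec, Finset.mul_sum, Matrix.of_apply, Pi.star_apply,
        star_trivial]
      refine Finset.sum_congr rfl fun i _ => Finset.sum_congr rfl fun j _ => by ring
  obtain ⟨B, hB⟩ : ∃ B : Matrix (Fin m) (Fin m) ℝ, Matrix.of (a p) = star B * B := by
    open scoped MatrixOrder Matrix.Norms.L2Operator in
    exact CStarAlgebra.nonneg_iff_eq_star_mul_self.mp hA.nonneg
  have hB' : ∀ i j, a p i j = ∑ k, B k i * B k j := fun i j => by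
    have := congrFun (congrFun hB i) j
    simpa [Matrix.mul_apply] using this
  unfold Lop
  have e1 : ∀ j, pd h j p = 0 := fun j => by simp [pd, hmin.fderiv_eq_zero]
  simp only [e1, mul_zero, Finset.sum_const_zero, add_zero]
  have : ∑ i, ∑ j, a p i j * pd2 h i j p = ∑ k, ∑ i, ∑ j, B k i * B k j * pd2 h i j p := by
    simp only [hB', Finset.sum_mul]
    conv_lhs => enter [2, i]; rw [Finset.sum_comm]
    rw [Finset.sum_comm]
  rw [this]
  exact Finset.sum_nonneg fun k _ => smp_hess hh hmin _

/-- squared Euclidean norm of `x - c` -/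
def smpq {m : ℕ} (c x : Fin m → ℝ) : ℝ := ∑ i, (x i - c i) ^ 2

lemma smpq_cont {m : ℕ} (c : Fin m → ℝ) : Continuous (smpq c) := by
  unfold smpq; fun_prop

lemma smpq_nonneg {m : ℕ} (c x : Fin m → ℝ) : 0 ≤ smpq c x :=
  Finset.sum_nonneg fun _ _ => sq_nonneg _

lemma smpq_pos {m : ℕ} {c x : Fin m → ℝ} (h : x ≠ c) : 0 < smpq c x := by
  obtain ⟨i, hi⟩ := Function.ne_iff.mp h
  refine Finset.sum_pos' (fun _ _ => sq_nonneg _) ⟨i, Finset.mem_univ _, ?_⟩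
  have := sub_ne_zero.mpr hi
  positivity

lemma smpq_dist {m : ℕ} {c x : Fin m → ℝ} {r : ℝ} (hr : 0 < r) (h : smpq c x < r ^ 2) :
    dist x c < r := by
  rw [dist_pi_lt_iff hr]
  intro i
  rw [Real.dist_eq]
  refine abs_lt_of_sq_lt_sq ?_ hr.le
  refine lt_of_le_of_lt ?_ h
  exact Finset.single_le_sum (f := fun i => (x i - c i) ^ 2) (fun _ _ => sq_nonneg _)
    (Finset.mem_univ i)

lemma smpq_mid {m : ℕ} (y z x : Fin m → ℝ) :
    smpq (fun i => (y i + z i) / 2) x = smpq y x / 2 + smpq z x / 2 - smpq y z / 4 := by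
  unfold smpq
  simp only [Finset.sum_div, ← Finset.sum_add_distrib, ← Finset.sum_sub_distrib]
  refine Finset.sum_congr rfl fun i _ => by ring

lemma smpq_hasFDerivAt {m : ℕ} (c x : Fin m → ℝ) :
    HasFDerivAt (smpq c)
      (∑ i, (2 * (x i - c i)) • (ContinuousLinearMap.proj i : (Fin m → ℝ) →L[ℝ] ℝ)) x := by
  unfold smpq
  refine HasFDerivAt.fun_sum fun i _ => ?_
  have h := ((hasFDerivAt_apply (𝕜 := ℝ) i x).sub_const (c i)).pow 2
  simpa using h

/-- the Hopf barrier -/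
noncomputable def smpw {m : ℕ} (ε α k : ℝ) (c x : Fin m → ℝ) : ℝ :=
  ε * Real.exp (-α * smpq c x) - k

lemma smpw_contDiff {m : ℕ} (ε α k : ℝ) (c : Fin m → ℝ) : ContDiff ℝ 2 (smpw ε α k c) := by
  unfold smpw smpq; fun_prop

lemma smpw_pd {m : ℕ} (ε α k : ℝ) (c x : Fin m → ℝ) (j : Fin m) :
    pd (smpw ε α k c) j x = (-2 * α * ε) * (Real.exp (-α * smpq c x) * (x j - c j)) := by
  have h := ((((smpq_hasFDerivAt c x).const_mul (-α)).exp).const_mul ε).sub_const k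
  have h' : HasFDerivAt (smpw ε α k c) _ x := h
  rw [pd, h'.fderiv]
  simp [Pi.single_apply]
  ring

lemma smpw_pd2 {m : ℕ} (ε α k : ℝ) (c x : Fin m → ℝ) (i j : Fin m) :
    pd2 (smpw ε α k c) i j x = ε * Real.exp (-α * smpq c x) *
      (4 * α ^ 2 * ((x i - c i) * (x j - c j)) - 2 * α * (if i = j then 1 else 0)) := by
  have h0 : (fun y => fderiv ℝ (smpw ε α k c) y (Pi.single j 1)) =
      fun y => (-2 * α * ε) * (Real.exp (-α * smpq c y) * (y j - c j)) :=
    funext fun y => smpw_pd ε α k c y j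
  have h1 := ((smpq_hasFDerivAt c x).const_mul (-α)).exp
  have h2 := (h1.mul ((hasFDerivAt_apply (𝕜 := ℝ) j x).sub_const (c j))).const_mul (-2 * α * ε)
  rw [pd2, h0]
  have h3 : HasFDerivAt
    (fun y => (-2 * α * ε) * (Real.exp (-α * smpq c y) * (y j - c j))) _ x := h2
  rw [h3.fderiv]
  by_cases hij : i = j
  · subst hij
    simp [Pi.single_apply]
    ring
  · simp [Pi.single_apply, hij, Ne.symm hij]
    ring

lemma smpw_Lop {m : ℕ} (a : (Fin m → ℝ) → Fin m → Fin m → ℝ) (b : (Fin m → ℝ) → Fin m → ℝ)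
    (ε α k : ℝ) (c x : Fin m → ℝ) :
    Lop a b (smpw ε α k c) x = ε * Real.exp (-α * smpq c x) *
      (4 * α ^ 2 * (∑ i, ∑ j, a x i j * (x i - c i) * (x j - c j))
        - 2 * α * (∑ i, a x i i + ∑ j, b x j * (x j - c j))) := by
  have e1 : ∑ i, ∑ j, a x i j * pd2 (smpw ε α k c) i j x = ε * Real.exp (-α * smpq c x) *
      (4 * α ^ 2 * (∑ i, ∑ j, a x i j * (x i - c i) * (x j - c j)) - 2 * α * ∑ i, a x i i) := by
    have : ∑ i, a x i i = ∑ i, ∑ j, a x i j * (if i = j then 1 else 0) := by simp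
    rw [this]
    simp only [smpw_pd2, Finset.mul_sum, ← Finset.sum_sub_distrib]
    refine Finset.sum_congr rfl fun i _ => Finset.sum_congr rfl fun j _ => by ring
  have e2 : ∑ j, b x j * pd (smpw ε α k c) j x = ε * Real.exp (-α * smpq c x) *
      (-2 * α * ∑ j, b x j * (x j - c j)) := by
    simp only [smpw_pd, Finset.mul_sum]
    refine Finset.sum_congr rfl fun i _ => by ring
  rw [Lop, e1, e2]; ring

lemma smp_hopf {m : ℕ} (D : Set (Fin m → ℝ)) (hDo : IsOpen D)
    (a : (Fin m → ℝ) → Fin m → Fin m → ℝ) (b : (Fin m → ℝ) → Fin m → ℝ)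
    (hell : UniformlyElliptic D a)
    (hacont : ∀ i j, ContinuousOn (fun x => a x i j) D)
    (hbcont : ∀ j, ContinuousOn (fun x => b x j) D)
    (f : (Fin m → ℝ) → ℝ) (hf : ContinuousOn f D) (hf0 : ∀ x ∈ D, 0 ≤ f x)
    (z c : Fin m → ℝ) (hzD : z ∈ D) (hz : f z = 0) (hR : 0 < smpq c z)
    (hball : ∀ᶠ x in 𝓝 z, f x = 0 → smpq c z + smpq z x / 2 ≤ smpq c x)
    (C : ℝ) (hC : 0 ≤ C)
    (H : ∀ᶠ x in 𝓝 z, ∃ u : (Fin m → ℝ) → ℝ, ContDiffAt ℝ 2 u x ∧ (∀ᶠ y in 𝓝 x, f y ≤ u y) ∧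
      u x = f x ∧ Lop a b u x ≤ C * f x) : False := by
  obtain ⟨hsym, lam, hlam, hel⟩ := hell
  set R := smpq c z with hRdef
  set T : (Fin m → ℝ) → ℝ := fun x => ∑ i, a x i i + ∑ j, b x j * (x j - c j) with hT
  have hDn := hDo.mem_nhds hzD
  have hTc : ContinuousAt T z := by
    have h1 : ∀ i j, ContinuousAt (fun x => a x i j) z := fun i j => (hacont i j).continuousAt hDn
    have h2 : ∀ j, ContinuousAt (fun x => b x j) z := fun j => (hbcont j).continuousAt hDn
    refine ContinuousAt.add (tendsto_finsetSum _ fun i _ => h1 i i)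
      (tendsto_finsetSum _ fun j _ => (h2 j).mul ?_)
    exact Continuous.continuousAt (by fun_prop)
  set M := |T z| + 1 with hM
  have hMpos : 0 < M := by positivity
  have ev1 : ∀ᶠ x in 𝓝 z, T x < M :=
    hTc.eventually_lt_const (by rw [hM]; linarith [le_abs_self (T z)])
  have ev2 : ∀ᶠ x in 𝓝 z, R / 2 < smpq c x :=
    (smpq_cont c).continuousAt.eventually_const_lt (by linarith)
  set s := 2 * lam * R with hs
  have hspos : 0 < s := by positivity
  obtain ⟨α, hα, hαC⟩ : ∃ α : ℝ, 0 < α ∧ C < s * α ^ 2 - 2 * α * M := by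
    refine ⟨(2 * M + C) / s + 1, by positivity, ?_⟩
    set A := (2 * M + C) / s with hA
    have hA0 : 0 ≤ A := by positivity
    have hAs : s * A = 2 * M + C := by rw [hA]; field_simp
    nlinarith [mul_nonneg hA0 hC, mul_nonneg hA0 hspos.le]
  obtain ⟨ρ, hρ, hK⟩ := Metric.nhds_basis_closedBall.eventually_iff.mp
    ((((ev1.and ev2).and hball).and H).and hDn)
  set K := Metric.closedBall z ρ with hKdef
  have hKc : IsCompact K := isCompact_closedBall z ρ
  have hKD : K ⊆ D := fun x hx => (hK hx).2
  have hfK : ContinuousOn f K := hf.mono hKD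
  obtain ⟨δ, hδ, hδf⟩ : ∃ δ : ℝ, 0 < δ ∧ ∀ x, dist x z = ρ → smpq c x ≤ R → δ ≤ f x := by
    set S := Metric.sphere z ρ ∩ {x | smpq c x ≤ R} with hS
    have hSc : IsCompact S :=
      (isCompact_sphere z ρ).inter_right (isClosed_le (smpq_cont c) continuous_const)
    have hSK : S ⊆ K := fun x hx => Metric.sphere_subset_closedBall hx.1
    rcases S.eq_empty_or_nonempty with he | hne
    · refine ⟨1, one_pos, fun x h1 h2 => ?_⟩
      have : x ∈ S := ⟨h1, h2⟩
      rw [he] at this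
      exact this.elim
    · obtain ⟨x0, hx0, hmin⟩ := hSc.exists_isMinOn hne (hfK.mono hSK)
      refine ⟨f x0, ?_, fun x h1 h2 => hmin ⟨h1, h2⟩⟩
      refine lt_of_le_of_ne (hf0 _ (hKD (hSK hx0))) fun h0 => ?_
      have h3 := (hK (hSK hx0)).1.1.2 h0.symm
      have h4 : x0 ≠ z := by
        rintro rfl
        have := hx0.1
        simp at this
        linarith
      have h5 := smpq_pos h4
      have h6 : smpq c x0 ≤ R := hx0.2
      linarith
  set k := δ * Real.exp (-α * R) with hk
  have hkpos : 0 < k := by positivity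
  set w := smpw δ α k c with hw
  have hwz : w z = 0 := by simp [hw, smpw, hk, ← hRdef]
  have hwC : ContDiff ℝ 2 w := smpw_contDiff _ _ _ _
  obtain ⟨p, hpK, hpmin⟩ := hKc.exists_isMinOn ⟨z, Metric.mem_closedBall_self hρ.le⟩
    (hfK.sub hwC.continuous.continuousOn)
  have hp0 : f p ≤ w p := by
    have := hpmin (Metric.mem_closedBall_self hρ.le)
    simp only [Set.mem_ofPred_eq, Pi.sub_apply, hz, hwz] at this
    linarith
  have hpD := hKD hpK
  have hpball : dist p z < ρ := by
    refine lt_of_le_of_ne hpK fun heq => ?_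
    rcases le_or_gt (smpq c p) R with h1 | h1
    · have h2 := hδf p heq h1
      have h3 : Real.exp (-α * smpq c p) ≤ 1 := by
        rw [Real.exp_le_one_iff]
        have := mul_nonneg hα.le (smpq_nonneg c p)
        linarith
      have h4 : w p = δ * Real.exp (-α * smpq c p) - k := rfl
      nlinarith
    · have h2 : w p = δ * Real.exp (-α * smpq c p) - k := rfl
      have h3 : Real.exp (-α * smpq c p) < Real.exp (-α * R) := by
        rw [Real.exp_lt_exp]
        nlinarith
      have h4 := mul_lt_mul_of_pos_left h3 hδ
      have := hf0 p hpD
      linarith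
  obtain ⟨⟨⟨⟨hp1, hp2⟩, -⟩, u, hu, huf, hup, huL⟩, -⟩ := hK hpK
  have hKn : K ∈ 𝓝 p := Metric.closedBall_mem_nhds_of_mem hpball
  have hmin : IsLocalMin (fun x => u x + (-1) * w x) p := by
    filter_upwards [huf, hKn] with x hx hxK
    have := hpmin hxK
    simp only [Set.mem_ofPred_eq, Pi.sub_apply] at this
    linarith
  have hw' : ContDiffAt ℝ 2 w p := hwC.contDiffAt
  have hnn := smp_Lop_min a b (hu.add (contDiffAt_const.mul hw')) hmin (hsym p hpD)
    (fun ξ => le_trans (by positivity) (hel p hpD ξ))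
  rw [smp_Lop_add a b hu (contDiffAt_const.mul hw'), smp_Lop_const_mul a b _ hw'] at hnn
  have hLw := smpw_Lop a b δ α k c p
  rw [← hw] at hLw
  have hE : 0 < δ * Real.exp (-α * smpq c p) := by positivity
  set E := δ * Real.exp (-α * smpq c p) with hEdef
  have hwE : w p = E - k := rfl
  have hell' := hel p hpD (fun i => p i - c i)
  have hq : lam * smpq c p ≤ ∑ i, ∑ j, a p i j * (p i - c i) * (p j - c j) := hell'
  set Q := ∑ i, ∑ j, a p i j * (p i - c i) * (p j - c j) with hQ
  have hTp : (∑ i, a p i i + ∑ j, b p j * (p j - c j)) = T p := rfl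
  rw [hTp] at hLw
  have hbig : C < 4 * α ^ 2 * Q - 2 * α * T p := by
    have h1 : lam * R / 2 ≤ Q := by nlinarith
    have h2 : s * α ^ 2 ≤ 4 * α ^ 2 * Q := by
      have := mul_le_mul_of_nonneg_left h1 (by positivity : 0 ≤ 4 * α ^ 2)
      calc s * α ^ 2 = 4 * α ^ 2 * (lam * R / 2) := by rw [hs]; ring
        _ ≤ _ := this
    have h3 : 2 * α * T p ≤ 2 * α * M := by gcongr
    linarith
  have h5 : E * C < Lop a b w p := by rw [hLw]; exact mul_lt_mul_of_pos_left hbig hE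
  have h6 : C * f p ≤ C * E := mul_le_mul_of_nonneg_left (by linarith) hC
  linarith

lemma smp_viscosity {m : ℕ} (D : Set (Fin m → ℝ)) (hDo : IsOpen D) (hDc : IsConnected D)
    (a : (Fin m → ℝ) → Fin m → Fin m → ℝ) (b : (Fin m → ℝ) → Fin m → ℝ)
    (hell : UniformlyElliptic D a)
    (hacont : ∀ i j, ContinuousOn (fun x => a x i j) D)
    (hbcont : ∀ j, ContinuousOn (fun x => b x j) D)
    (f : (Fin m → ℝ) → ℝ) (hf : ContinuousOn f D) (hf0 : ∀ x ∈ D, 0 ≤ f x)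
    (H : ∀ z ∈ D, f z = 0 → ∃ C : ℝ, 0 ≤ C ∧ ∀ᶠ x in 𝓝 z, ∃ u : (Fin m → ℝ) → ℝ,
      ContDiffAt ℝ 2 u x ∧ (∀ᶠ y in 𝓝 x, f y ≤ u y) ∧ u x = f x ∧ Lop a b u x ≤ C * f x)
    (hex : ∃ x₀ ∈ D, f x₀ = 0) : ∀ x ∈ D, f x = 0 := by
  by_contra! hcon
  obtain ⟨x1, hx1, hfx1⟩ := hcon
  obtain ⟨x0, hx0, hfx0⟩ := hex
  -- a zero which is a limit of non-zeros
  obtain ⟨z, hzD, hz, hzf⟩ : ∃ z ∈ D, f z = 0 ∧ ¬ ∀ᶠ x in 𝓝 z, f x = 0 := by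
    by_contra! hall
    have hU : IsOpen {x | x ∈ D ∧ f x ≠ 0} := by
      rw [isOpen_iff_mem_nhds]
      rintro x ⟨hx, hfx⟩
      have := ((hf.continuousAt (hDo.mem_nhds hx)).eventually_ne hfx)
      filter_upwards [this, hDo.mem_nhds hx] with y h1 h2 using ⟨h2, h1⟩
    have hV : IsOpen {x | x ∈ D ∧ f x = 0} := by
      rw [isOpen_iff_mem_nhds]
      rintro x ⟨hx, hfx⟩
      filter_upwards [hall x hx hfx, hDo.mem_nhds hx] with y h1 h2 using ⟨h2, h1⟩
    obtain ⟨y, hyD, h1, h2⟩ := hDc.isPreconnected _ _ hU hV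
      (fun x hx => by
        by_cases h : f x = 0
        · exact Or.inr ⟨hx, h⟩
        · exact Or.inl ⟨hx, h⟩) ⟨x1, hx1, hx1, hfx1⟩ ⟨x0, hx0, hx0, hfx0⟩
    exact h1.2 h2.2
  obtain ⟨ρ, hρ, hρD⟩ := Metric.nhds_basis_closedBall.mem_iff.mp (hDo.mem_nhds hzD)
  have hzq : smpq z z = 0 := by simp [smpq]
  have ev : ∀ᶠ y in 𝓝 z, smpq z y < (ρ / 2) ^ 2 :=
    (smpq_cont z).continuousAt.eventually_lt_const (by rw [hzq]; positivity)
  obtain ⟨y, hy0, hyq⟩ := ((not_eventually.mp hzf).and_eventually ev).exists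
  have hcomm : ∀ x y : Fin m → ℝ, smpq x y = smpq y x := fun x y =>
    Finset.sum_congr rfl fun i _ => by ring
  have hyz : dist y z < ρ / 2 := smpq_dist (by positivity) hyq
  have hcompact : IsCompact (Metric.closedBall z ρ ∩ f ⁻¹' {0}) :=
    (isCompact_closedBall z ρ).of_isClosed_subset
      ((hf.mono hρD).preimage_isClosed_of_isClosed Metric.isClosed_closedBall isClosed_singleton)
      Set.inter_subset_left
  obtain ⟨z', ⟨hz'K, hz'0⟩, hz'min⟩ := hcompact.exists_isMinOn
    ⟨z, Metric.mem_closedBall_self hρ.le, hz⟩ (smpq_cont y).continuousOn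
  have hz'0 : f z' = 0 := hz'0
  have h1 : smpq y z' ≤ smpq y z := hz'min ⟨Metric.mem_closedBall_self hρ.le, hz⟩
  have h2 : dist z' y < ρ / 2 := smpq_dist (by positivity) (by rw [hcomm y z] at h1; linarith)
  have h3 : dist z' z < ρ := by linarith [dist_triangle z' y z]
  have hz'D : z' ∈ D := hρD hz'K
  have hne : z' ≠ y := fun h => hy0 (h ▸ hz'0)
  have hr := smpq_pos hne
  obtain ⟨C, hC, HC⟩ := H z' hz'D hz'0
  have hz'q : smpq z' z' = 0 := by simp [smpq]
  refine smp_hopf D hDo a b hell hacont hbcont f hf hf0 z' (fun i => (y i + z' i) / 2) hz'D hz'0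
    ?_ ?_ C hC HC
  · rw [smpq_mid, hz'q]; linarith
  · filter_upwards [Metric.closedBall_mem_nhds_of_mem h3] with x hx hfx
    have h4 : smpq y z' ≤ smpq y x := hz'min ⟨hx, hfx⟩
    rw [smpq_mid, smpq_mid, hz'q]
    linarith

lemma smp_quad_sub_le {n : ℕ} (θ η : Fin n → Fin n → ℝ) (v : Fin n → ℝ) (hv : ∀ i, |v i| ≤ 1) :
    quadForm η v - (n * n : ℝ) * ‖θ - η‖ ≤ quadForm θ v := by
  have h : quadForm η v - quadForm θ v ≤ ∑ _i : Fin n, ∑ _j : Fin n, ‖θ - η‖ := by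
    unfold quadForm
    simp only [← Finset.sum_sub_distrib]
    refine Finset.sum_le_sum fun i _ => Finset.sum_le_sum fun j _ => ?_
    have h1 : |θ i j - η i j| ≤ ‖θ - η‖ :=
      (norm_le_pi_norm ((θ - η) i) j).trans (norm_le_pi_norm (θ - η) i)
    calc v i * η i j * v j - v i * θ i j * v j = -(v i * v j * (θ i j - η i j)) := by ring
      _ ≤ |v i * v j * (θ i j - η i j)| := neg_le_abs _
      _ = |v i| * |v j| * |θ i j - η i j| := by rw [abs_mul, abs_mul]
      _ ≤ 1 * 1 * ‖θ - η‖ := by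
        have := hv i
        have := hv j
        gcongr
      _ = _ := by ring
  simp only [Finset.sum_const, Finset.card_univ, Fintype.card_fin, nsmul_eq_mul] at h
  nlinarith

/-- the Euclidean unit sphere -/
def smpS (n : ℕ) : Set (Fin n → ℝ) := {v | ∑ i, v i ^ 2 = 1}

lemma smpS_abs {n : ℕ} {v : Fin n → ℝ} (hv : v ∈ smpS n) (i : Fin n) : |v i| ≤ 1 := by
  have h : v i ^ 2 ≤ ∑ i, v i ^ 2 :=
    Finset.single_le_sum (f := fun i => v i ^ 2) (fun _ _ => sq_nonneg _) (Finset.mem_univ i)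
  have h2 : ∑ i, v i ^ 2 = 1 := hv
  rw [h2] at h
  exact (sq_le_one_iff_abs_le_one _).mp h

lemma smpS_compact (n : ℕ) : IsCompact (smpS n) := by
  refine (isCompact_closedBall (0 : Fin n → ℝ) 1).of_isClosed_subset ?_ ?_
  · exact isClosed_eq (by fun_prop) continuous_const
  · intro v hv
    rw [mem_closedBall_zero_iff, pi_norm_le_iff_of_nonneg zero_le_one]
    exact fun i => smpS_abs hv i

/-- the smallest eigenvalue -/
noncomputable def smpg {n : ℕ} (θ : Fin n → Fin n → ℝ) : ℝ := sInf (quadForm θ '' smpS n)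

lemma smpg_cont {n : ℕ} : Continuous (smpg (n := n)) := by
  refine (smpS_compact n).continuous_sInf ?_
  show Continuous fun p : (Fin n → Fin n → ℝ) × (Fin n → ℝ) =>
    ∑ i, ∑ j, p.2 i * p.1 i j * p.2 j
  fun_prop

lemma smpg_min {n : ℕ} (hn : 0 < n) (θ : Fin n → Fin n → ℝ) :
    ∃ v ∈ smpS n, quadForm θ v = smpg θ ∧ ∀ v' ∈ smpS n, smpg θ ≤ quadForm θ v' := by
  have hne : (smpS n).Nonempty := ⟨Pi.single ⟨0, hn⟩ 1, by simp [smpS, Pi.single_apply]⟩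
  have hc : ContinuousOn (quadForm θ) (smpS n) := by
    unfold quadForm; fun_prop
  obtain ⟨v, hv, h1, h2⟩ := (smpS_compact n).exists_sInf_image_eq_and_le hne hc
  refine ⟨v, hv, h1.symm, fun v' hv' => ?_⟩
  unfold smpg
  rw [h1]
  exact h2 v' hv'

lemma smpg_le {n : ℕ} (hn : 0 < n) (θ : Fin n → Fin n → ℝ) (v : Fin n → ℝ) :
    smpg θ * ∑ i, v i ^ 2 ≤ quadForm θ v := by
  obtain ⟨-, -, -, hmin⟩ := smpg_min hn θ
  by_cases h0 : ∑ i, v i ^ 2 = 0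
  · have hv : v = 0 := by
      ext i
      have := (Finset.sum_eq_zero_iff_of_nonneg (fun i _ => sq_nonneg (v i))).mp h0 i
        (Finset.mem_univ i)
      simpa using this
    subst hv
    simp [quadForm]
  · have hpos : 0 < ∑ i, v i ^ 2 :=
      lt_of_le_of_ne (Finset.sum_nonneg fun _ _ => sq_nonneg _) (Ne.symm h0)
    set N := ∑ i, v i ^ 2 with hN
    set t := Real.sqrt N with ht
    have ht2 : t ^ 2 = N := Real.sq_sqrt hpos.le
    have htpos : 0 < t := Real.sqrt_pos.mpr hpos
    have hS : (fun i => v i / t) ∈ smpS n := by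
      simp only [smpS, Set.mem_ofPred_eq, div_pow, ← Finset.sum_div]
      rw [ht2, ← hN]; exact div_self h0
    have h1 := hmin _ hS
    have h2 : quadForm θ (fun i => v i / t) * N = quadForm θ v := by
      rw [← ht2]
      unfold quadForm
      simp only [Finset.sum_mul]
      refine Finset.sum_congr rfl fun i _ => Finset.sum_congr rfl fun j _ => by field_simp
    rw [← h2]
    exact mul_le_mul_of_nonneg_right h1 hpos.le

lemma smp_Lop_quad {m n : ℕ} (a : (Fin m → ℝ) → Fin m → Fin m → ℝ)
    (b : (Fin m → ℝ) → Fin m → ℝ) (φ : (Fin m → ℝ) → Fin n → Fin n → ℝ) (v : Fin n → ℝ)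
    {x : Fin m → ℝ} (hφ : ∀ i j, ContDiffAt ℝ 2 (fun y => φ y i j) x) :
    ContDiffAt ℝ 2 (fun y => quadForm (φ y) v) x ∧
    Lop a b (fun y => quadForm (φ y) v) x = ∑ i, ∑ j, v i * v j * Lop a b (fun y => φ y i j) x := by
  have e : (fun y => quadForm (φ y) v) = fun y => ∑ i, ∑ j, (v i * v j) * φ y i j := by
    funext y
    unfold quadForm
    refine Finset.sum_congr rfl fun i _ => Finset.sum_congr rfl fun j _ => by ring
  have h1 : ∀ i j, ContDiffAt ℝ 2 (fun y => (v i * v j) * φ y i j) x := fun i j =>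
    contDiffAt_const.mul (hφ i j)
  have h2 : ∀ i, ContDiffAt ℝ 2 (fun y => ∑ j, (v i * v j) * φ y i j) x := fun i =>
    ContDiffAt.sum fun j _ => h1 i j
  rw [e]
  refine ⟨ContDiffAt.sum fun i _ => h2 i, ?_⟩
  rw [smp_Lop_sum a b _ (fun i y => ∑ j, (v i * v j) * φ y i j) h2]
  refine Finset.sum_congr rfl fun i _ => ?_
  rw [smp_Lop_sum a b _ (fun j y => (v i * v j) * φ y i j) (h1 i)]
  refine Finset.sum_congr rfl fun j _ => ?_
  rw [smp_Lop_const_mul a b _ (hφ i j)]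

lemma smp_quad_single {n : ℕ} (θ : Fin n → Fin n → ℝ) (i : Fin n) :
    quadForm θ (Pi.single i 1) = θ i i := by
  simp [quadForm, Pi.single_apply]

lemma smp_psd_norm {n : ℕ} (θ : Fin n → Fin n → ℝ) (hs : ∀ i j, θ i j = θ j i)
    (hp : ∀ v, 0 ≤ quadForm θ v) : ‖θ‖ ≤ ∑ i, θ i i := by
  have hd : ∀ i, 0 ≤ θ i i := fun i => smp_quad_single θ i ▸ hp _
  have htr : 0 ≤ ∑ i, θ i i := Finset.sum_nonneg fun i _ => hd i
  have hle : ∀ i, θ i i ≤ ∑ i, θ i i := fun i =>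
    Finset.single_le_sum (f := fun i => θ i i) (fun i _ => hd i) (Finset.mem_univ i)
  rw [pi_norm_le_iff_of_nonneg htr]
  intro i
  rw [pi_norm_le_iff_of_nonneg htr]
  intro j
  have key : ∀ t : ℝ, quadForm θ (fun k => (if k = i then 1 else 0) + t * (if k = j then 1 else 0))
      = θ i i + t * θ i j + t * θ j i + t ^ 2 * θ j j := by
    intro t
    unfold quadForm
    simp only [add_mul, mul_add, Finset.sum_add_distrib, mul_ite, ite_mul, mul_one, mul_zero,
      one_mul, zero_mul, Finset.sum_ite_eq', Finset.mem_univ, if_true, Finset.sum_ite_irrel,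
      Finset.sum_const_zero]
    ring
  have h1 := hp (fun k => (if k = i then 1 else 0) + 1 * (if k = j then 1 else 0))
  have h2 := hp (fun k => (if k = i then 1 else 0) + (-1) * (if k = j then 1 else 0))
  rw [key] at h1 h2
  have h3 := hle i
  have h4 := hle j
  have h5 := hs i j
  rw [Real.norm_eq_abs, abs_le]
  constructor <;> linarith

/-- **Strong elliptic maximum principle for symmetric 2-tensors (elliptic Hamilton
maximum principle).**  Let `φ : D → Sym(n, ℝ)` be a smooth positive semidefinite solution
of `Lφ + Ψ(φ) = 0` (with `L` uniformly elliptic acting entrywise) where the smooth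
fiberwise map `Ψ` satisfies the null-eigenvector condition.  If `φ` has a zero eigenvalue
at some point of `D`, then it has a zero eigenvalue everywhere on `D`; if `φ` vanishes at
some point of `D`, it vanishes identically on `D`. -/
theorem strong_maximum_principle_symmetric_tensors
    (m n : ℕ) (D : Set (Fin m → ℝ)) (hDo : IsOpen D) (hDc : IsConnected D)
    (a : (Fin m → ℝ) → Fin m → Fin m → ℝ) (b : (Fin m → ℝ) → Fin m → ℝ)
    (hell : UniformlyElliptic D a)
    (hacont : ∀ i j, ContinuousOn (fun x => a x i j) D)
    (hbcont : ∀ j, ContinuousOn (fun x => b x j) D)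
    (Ψ : (Fin n → Fin n → ℝ) → (Fin n → Fin n → ℝ))
    (hΨsmooth : ContDiff ℝ (⊤ : ℕ∞) Ψ)
    (hΨsym : ∀ θ : Fin n → Fin n → ℝ, (∀ i j, θ i j = θ j i) → ∀ i j, Ψ θ i j = Ψ θ j i)
    (hΨnull : NullEigenvectorCondition Ψ)
    (φ : (Fin m → ℝ) → Fin n → Fin n → ℝ)
    (hφsmooth : ∀ i j, ContDiffOn ℝ (⊤ : ℕ∞) (fun x => φ x i j) D)
    (hφsym : ∀ x ∈ D, ∀ i j, φ x i j = φ x j i)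
    (hφpsd : ∀ x ∈ D, ∀ v, 0 ≤ quadForm (φ x) v)
    (heq : ∀ x ∈ D, ∀ i j, Lop a b (fun y => φ y i j) x + Ψ (φ x) i j = 0) :
    ((∃ x₀ ∈ D, ∃ v : Fin n → ℝ, v ≠ 0 ∧ quadForm (φ x₀) v = 0) →
      ∀ x ∈ D, ∃ v : Fin n → ℝ, v ≠ 0 ∧ quadForm (φ x) v = 0) ∧
    ((∃ x₀ ∈ D, φ x₀ = 0) → ∀ x ∈ D, φ x = 0) := by
  have hφ2 : ∀ x ∈ D, ∀ i j, ContDiffAt ℝ 2 (fun y => φ y i j) x := fun x hx i j =>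
    ((hφsmooth i j).contDiffAt (hDo.mem_nhds hx)).of_le
      (WithTop.coe_le_coe.mpr (le_top : (2 : ℕ∞) ≤ ⊤))
  have hφc : ∀ x ∈ D, ContinuousAt φ x := fun x hx =>
    continuousAt_pi.mpr fun i => continuousAt_pi.mpr fun j => (hφ2 x hx i j).continuousAt
  have hL : ∀ x ∈ D, ∀ i j, Lop a b (fun y => φ y i j) x = - Ψ (φ x) i j := fun x hx i j => by
    linarith [heq x hx i j]
  have hLip : ∀ θ, ∃ K : NNReal, ∃ t ∈ 𝓝 θ, LipschitzOnWith K Ψ t := fun θ =>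
    ContDiffAt.exists_lipschitzOnWith (𝕂 := ℝ)
      (hΨsmooth.contDiffAt.of_le (by exact_mod_cast le_top))
  constructor
  · rintro ⟨x₀, hx₀, v₀, hv₀, hq₀⟩
    have hn : 0 < n := by
      rcases Nat.eq_zero_or_pos n with rfl | h
      · exact (hv₀ (Subsingleton.elim _ _)).elim
      · exact h
    have hnonneg : ∀ x ∈ D, 0 ≤ smpg (φ x) := fun x hx => by
      obtain ⟨v, -, h1, -⟩ := smpg_min hn (φ x)
      rw [← h1]; exact hφpsd x hx v
    have hmain := smp_viscosity D hDo hDc a b hell hacont hbcont (fun x => smpg (φ x))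
      (fun x hx => (smpg_cont.continuousAt.comp (hφc x hx)).continuousWithinAt) hnonneg ?_ ?_
    · intro x hx
      obtain ⟨v, hv, h1, -⟩ := smpg_min hn (φ x)
      refine ⟨v, ?_, h1.trans (hmain x hx)⟩
      rintro rfl
      simp [smpS] at hv
    · intro z hz hgz
      obtain ⟨K, t, ht, hKt⟩ := hLip (φ z)
      set I : Fin n → Fin n → ℝ := fun i j => if i = j then 1 else 0 with hI
      have hI2 : ∀ v, quadForm I v = ∑ i, v i ^ 2 := fun v => by
        simp [quadForm, hI, sq]
      refine ⟨n * n * (K * ‖I‖), by positivity, ?_⟩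
      have hgc : ContinuousAt (fun x => smpg (φ x)) z :=
        smpg_cont.continuousAt.comp (hφc z hz)
      have hθc : ContinuousAt (fun x => φ x - smpg (φ x) • I) z :=
        (hφc z hz).sub (hgc.smul continuousAt_const)
      have hgz' : smpg (φ z) = 0 := hgz
      have ht' : t ∈ 𝓝 (φ z - smpg (φ z) • I) := by rw [hgz']; simpa using ht
      filter_upwards [hDo.mem_nhds hz, hφc z hz ht, hθc ht'] with x hx hxt hxt'
      obtain ⟨v, hv, h1, -⟩ := smpg_min hn (φ x)
      have hv1 : ∑ i, v i ^ 2 = 1 := hv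
      obtain ⟨hu, hLu⟩ := smp_Lop_quad a b φ v (hφ2 x hx)
      refine ⟨fun y => quadForm (φ y) v, hu, Eventually.of_forall fun y => ?_, h1, ?_⟩
      · have := smpg_le hn (φ y) v
        rw [hv1, mul_one] at this
        exact this
      · have hLu' : Lop a b (fun y => quadForm (φ y) v) x = - quadForm (Ψ (φ x)) v := by
          rw [hLu]
          unfold quadForm
          simp only [← Finset.sum_neg_distrib, hL x hx]
          refine Finset.sum_congr rfl fun i _ => Finset.sum_congr rfl fun j _ => by ring
        set θ := φ x - smpg (φ x) • I with hθ
        have hθq : ∀ v', quadForm θ v' = quadForm (φ x) v' - smpg (φ x) * ∑ i, v' i ^ 2 := by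
          intro v'
          rw [← hI2]
          unfold quadForm
          simp only [Finset.mul_sum, ← Finset.sum_sub_distrib, hθ, Pi.sub_apply, Pi.smul_apply,
            smul_eq_mul]
          refine Finset.sum_congr rfl fun i _ => Finset.sum_congr rfl fun j _ => by ring
        have hnull := hΨnull θ
          (fun i j => by simp [hθ, hI, hφsym x hx i j, eq_comm])
          (fun v' => by rw [hθq]; linarith [smpg_le hn (φ x) v'])
          v (by rw [hθq, hv1, h1]; ring)
        have h2 := smp_quad_sub_le (Ψ (φ x)) (Ψ θ) v (smpS_abs hv)
        have h3 : ‖Ψ (φ x) - Ψ θ‖ ≤ K * (smpg (φ x) * ‖I‖) := by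
          have h4 := hKt.norm_sub_le hxt hxt'
          have h5 : φ x - θ = smpg (φ x) • I := by rw [hθ]; abel
          rwa [h5, norm_smul, Real.norm_of_nonneg (hnonneg x hx)] at h4
        have h6 : (n * n : ℝ) * ‖Ψ (φ x) - Ψ θ‖ ≤ n * n * (K * (smpg (φ x) * ‖I‖)) := by
          gcongr
        rw [hLu']
        have h7 : (n * n : ℝ) * (K * (smpg (φ x) * ‖I‖)) = n * n * (K * ‖I‖) * smpg (φ x) := by
          ring
        linarith
    · refine ⟨x₀, hx₀, ?_⟩
      have h1 := smpg_le hn (φ x₀) v₀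
      have h2 : 0 < ∑ i, v₀ i ^ 2 := by
        have := smpq_pos hv₀
        simpa [smpq] using this
      have h3 := hnonneg x₀ hx₀
      rw [hq₀] at h1
      show smpg (φ x₀) = 0
      nlinarith
  · rintro ⟨x₀, hx₀, h0⟩
    have hnorm : ∀ x ∈ D, ‖φ x‖ ≤ ∑ i, φ x i i := fun x hx =>
      smp_psd_norm _ (hφsym x hx) (hφpsd x hx)
    have hfC : ∀ x ∈ D, ContDiffAt ℝ 2 (fun x => ∑ i, φ x i i) x := fun x hx =>
      ContDiffAt.sum fun i _ => hφ2 x hx i i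
    have hmain := smp_viscosity D hDo hDc a b hell hacont hbcont (fun x => ∑ i, φ x i i)
      (fun x hx => (hfC x hx).continuousAt.continuousWithinAt)
      (fun x hx => (norm_nonneg _).trans (hnorm x hx)) ?_ ⟨x₀, hx₀, by simp [h0]⟩
    · intro x hx
      have h1 := hnorm x hx
      have h2 : ∑ i, φ x i i = 0 := hmain x hx
      rw [h2] at h1
      exact norm_le_zero_iff.mp h1
    · intro z hz hfz
      have hφz : φ z = 0 := by
        have h1 := hnorm z hz
        have h2 : ∑ i, φ z i i = 0 := hfz
        rw [h2] at h1
        exact norm_le_zero_iff.mp h1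
      obtain ⟨K, t, ht, hKt⟩ := hLip (φ z)
      refine ⟨n * K, by positivity, ?_⟩
      filter_upwards [hDo.mem_nhds hz, hφc z hz ht] with x hx hxt
      refine ⟨fun x => ∑ i, φ x i i, hfC x hx, Eventually.of_forall fun y => le_rfl, rfl, ?_⟩
      rw [smp_Lop_sum a b _ (fun i y => φ y i i) (fun i => hφ2 x hx i i)]
      have h4 := hKt.norm_sub_le hxt (mem_of_mem_nhds ht)
      rw [hφz, sub_zero] at h4
      have h5 : ‖Ψ (φ x) - Ψ 0‖ ≤ K * ∑ i, φ x i i :=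
        h4.trans (mul_le_mul_of_nonneg_left (hnorm x hx) K.2)
      calc ∑ i, Lop a b (fun y => φ y i i) x ≤ ∑ _i : Fin n, K * ∑ i, φ x i i := by
            refine Finset.sum_le_sum fun i _ => ?_
            rw [hL x hx]
            have h6 := hΨnull 0 (by simp) (by simp [quadForm]) (Pi.single i 1) (by simp [quadForm])
            rw [smp_quad_single] at h6
            have h7 : |Ψ (φ x) i i - Ψ 0 i i| ≤ ‖Ψ (φ x) - Ψ 0‖ :=
              (norm_le_pi_norm ((Ψ (φ x) - Ψ 0) i) i).trans (norm_le_pi_norm (Ψ (φ x) - Ψ 0) i)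
            have h8 := (abs_le.mp h7).1
            linarith
        _ = n * K * ∑ i, φ x i i := by
            simp only [Finset.sum_const, Finset.card_univ, Fintype.card_fin, nsmul_eq_mul]; ring
end

section
/- Let K ⊆ Sym(n, ℝ) be the closed convex cone of positive semidefinite symmetric n×n real matrices, regarded as a subset of the inner product space Sym(n, ℝ) with the Frobenius inner product, and let θ ∈ K. Then the tangent cone of K at θ, namely the closure of { t(A − θ) : t ≥ 0, A ∈ K }, equals { ψ ∈ Sym(n, ℝ) : vᵀψv ≥ 0 for every v ∈ ℝⁿ with vᵀθv = 0 }. -/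
/-- The closed convex cone of positive semidefinite symmetric `n × n` real matrices,
regarded inside the space `Sym(n, ℝ)` of symmetric matrices. -/
def PSDCone (n : ℕ) : Set (Fin n → Fin n → ℝ) :=
  {θ | (∀ i j, θ i j = θ j i) ∧ ∀ v, 0 ≤ quadForm θ v}

lemma quadForm_add_aux {n : ℕ} (a b : Fin n → Fin n → ℝ) (v : Fin n → ℝ) :
    quadForm (a + b) v = quadForm a v + quadForm b v := by
  simp only [quadForm, Pi.add_apply, ← Finset.sum_add_distrib]
  refine Finset.sum_congr rfl fun i _ => Finset.sum_congr rfl fun j _ => by ring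

lemma quadForm_smul_aux {n : ℕ} (t : ℝ) (a : Fin n → Fin n → ℝ) (v : Fin n → ℝ) :
    quadForm (t • a) v = t * quadForm a v := by
  simp only [quadForm, Pi.smul_apply, smul_eq_mul, Finset.mul_sum]
  refine Finset.sum_congr rfl fun i _ => Finset.sum_congr rfl fun j _ => by ring

lemma quadForm_vec_smul_aux {n : ℕ} (t : ℝ) (a : Fin n → Fin n → ℝ) (v : Fin n → ℝ) :
    quadForm a (t • v) = t ^ 2 * quadForm a v := by
  simp only [quadForm, Pi.smul_apply, smul_eq_mul, Finset.mul_sum]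
  refine Finset.sum_congr rfl fun i _ => Finset.sum_congr rfl fun j _ => by ring

lemma quadForm_cont_vec_aux {n : ℕ} (a : Fin n → Fin n → ℝ) :
    Continuous fun v => quadForm a v := by
  unfold quadForm; fun_prop

lemma quadForm_cont_mat_aux {n : ℕ} (v : Fin n → ℝ) :
    Continuous fun a : Fin n → Fin n → ℝ => quadForm a v := by
  unfold quadForm; fun_prop

/-- identity matrix -/
def idAux (n : ℕ) : Fin n → Fin n → ℝ := fun i j => if i = j then 1 else 0

lemma quadForm_id_aux {n : ℕ} (v : Fin n → ℝ) : quadForm (idAux n) v = ∑ i, v i ^ 2 := by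
  simp [quadForm, idAux, pow_two]

lemma quadForm_id_pos_aux {n : ℕ} (v : Fin n → ℝ) (hv : v ≠ 0) : 0 < quadForm (idAux n) v := by
  rw [quadForm_id_aux]
  obtain ⟨i, hi⟩ := Function.ne_iff.mp hv
  exact Finset.sum_pos' (fun j _ => sq_nonneg _) ⟨i, Finset.mem_univ _, by
    have : v i ≠ 0 := hi
    positivity⟩

lemma exists_shift_aux {n : ℕ} (θ φ : Fin n → Fin n → ℝ) (hθ : ∀ v, 0 ≤ quadForm θ v)
    (hφ : ∀ v, v ≠ 0 → quadForm θ v = 0 → 0 < quadForm φ v) :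
    ∃ t : ℝ, 0 < t ∧ ∀ v, 0 ≤ quadForm φ v + t * quadForm θ v := by
  have hc : IsCompact (Metric.sphere (0 : Fin n → ℝ) 1) := isCompact_sphere 0 1
  obtain ⟨m, hm⟩ := hc.elim_directed_cover
    (fun m : ℕ => {v : Fin n → ℝ | 0 < quadForm φ v + (m : ℝ) * quadForm θ v})
    (fun m => isOpen_lt continuous_const
      ((quadForm_cont_vec_aux φ).add (continuous_const.mul (quadForm_cont_vec_aux θ))))
    (by
      intro v hv
      have hv0 : v ≠ 0 := by
        rintro rfl
        simp at hv
      rw [Set.mem_iUnion]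
      rcases (hθ v).eq_or_lt with h | h
      · refine ⟨0, ?_⟩
        simpa using hφ v hv0 h.symm
      · obtain ⟨m, hm⟩ := exists_nat_gt (-quadForm φ v / quadForm θ v)
        refine ⟨m, ?_⟩
        rw [div_lt_iff₀ h] at hm
        simp only [Set.mem_setOf_eq]
        linarith)
    (by
      refine Monotone.directed_le ?_
      intro a b hab v hv
      simp only [Set.mem_setOf_eq] at hv
      simp only [Set.mem_setOf_eq]
      have : (a : ℝ) * quadForm θ v ≤ b * quadForm θ v :=
        mul_le_mul_of_nonneg_right (by exact_mod_cast hab) (hθ v)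
      linarith)
  refine ⟨m + 1, by positivity, fun v => ?_⟩
  by_cases hv : v = 0
  · subst hv
    simp [quadForm]
  have hn : 0 < ‖v‖ := norm_pos_iff.mpr hv
  have hu : ‖v‖⁻¹ • v ∈ Metric.sphere (0 : Fin n → ℝ) 1 := by
    simp [norm_smul, hn.ne']
  have h := hm hu
  simp only [Set.mem_setOf_eq] at h
  rw [quadForm_vec_smul_aux, quadForm_vec_smul_aux] at h
  have h2 : 0 < (‖v‖⁻¹) ^ 2 * (quadForm φ v + m * quadForm θ v) := by linarith
  have h3 := (pos_iff_pos_of_mul_pos h2).mp (by positivity)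
  linarith [hθ v]

/-- **Tangent cone of the PSD cone.**  For `θ` in the cone `K` of positive semidefinite
symmetric `n × n` matrices, the tangent cone of `K` at `θ`, i.e. the closure of
`{ t (A − θ) : t ≥ 0, A ∈ K }`, equals the set of symmetric matrices `ψ` with `vᵀ ψ v ≥ 0`
for every null-eigenvector `v` of `θ` (i.e. every `v` with `vᵀ θ v = 0`). -/
theorem tangent_cone_of_PSD_cone (n : ℕ) (θ : Fin n → Fin n → ℝ) (hθ : θ ∈ PSDCone n) :
    closure {ψ : Fin n → Fin n → ℝ | ∃ t : ℝ, 0 ≤ t ∧ ∃ A ∈ PSDCone n, ψ = t • (A - θ)} =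
      {ψ : Fin n → Fin n → ℝ | (∀ i j, ψ i j = ψ j i) ∧
        ∀ v : Fin n → ℝ, quadForm θ v = 0 → 0 ≤ quadForm ψ v} := by
  obtain ⟨hs, hp⟩ := hθ
  apply Set.Subset.antisymm
  · apply closure_minimal
    · rintro ψ ⟨t, ht, A, ⟨hAs, hAp⟩, rfl⟩
      refine ⟨fun i j => by simp [hs i j, hAs i j], fun v hv => ?_⟩
      have h : A = (A - θ) + θ := by simp
      have h2 := quadForm_add_aux (A - θ) θ v
      rw [← h, hv] at h2
      rw [quadForm_smul_aux]
      exact mul_nonneg ht (by linarith [hAp v])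
    · simp only [Set.setOf_and, Set.setOf_forall]
      refine IsClosed.inter ?_ ?_
      · exact isClosed_iInter fun i => isClosed_iInter fun j =>
          isClosed_eq (by fun_prop) (by fun_prop)
      · exact isClosed_iInter fun v => isClosed_iInter fun _ =>
          isClosed_le continuous_const (quadForm_cont_mat_aux v)
  · rintro ψ ⟨hψs, hψ⟩
    have ht : Filter.Tendsto (fun ε : ℝ => ψ + ε • idAux n) (nhdsWithin 0 (Set.Ioi 0))
        (nhds ψ) := by
      have : Continuous (fun ε : ℝ => ψ + ε • idAux n) := by fun_prop
      have h := this.tendsto 0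
      simp only [zero_smul, add_zero] at h
      exact h.mono_left nhdsWithin_le_nhds
    refine mem_closure_of_tendsto ht ?_
    filter_upwards [self_mem_nhdsWithin] with ε hε
    have hε : 0 < ε := hε
    obtain ⟨t, ht0, h⟩ := exists_shift_aux θ (ψ + ε • idAux n) hp (by
      intro v hv h0
      rw [quadForm_add_aux, quadForm_smul_aux]
      have := mul_pos hε (quadForm_id_pos_aux v hv)
      linarith [hψ v h0])
    refine ⟨t, ht0.le, t⁻¹ • (ψ + ε • idAux n) + θ, ⟨fun i j => ?_, fun v => ?_⟩, ?_⟩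
    · simp [hs i j, hψs i j, idAux, eq_comm]
    · rw [quadForm_add_aux, quadForm_smul_aux]
      have h4 := mul_nonneg (inv_pos.mpr ht0).le (h v)
      rw [mul_add, ← mul_assoc, inv_mul_cancel₀ ht0.ne', one_mul] at h4
      exact h4
    · rw [add_sub_cancel_right, smul_inv_smul₀ ht0.ne']
end
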